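/- Let R be a definably connected definable ring and let e ∈ R be a nonzero idempotent element (e·e = e). Then there is a smallest definable subring R(e) of R containing e, and e is a multiplicative identity of R(e): e·x = x·e = x for all x ∈ R(e). -/

import Mathlib

open FirstOrder

namespace OMin

variable (L : FirstOrder.Language) (M : Type) [L.Structure M]

/-- A set of tuples from `M` is *definable* (with arbitrary parameters from `M`). -/
def Defin {α : Type} (s : Set (α → M)) : Prop :=
  Set.Definable (Set.univ : Set M) L s

section Order

variable [LinearOrder M]

/-- A subset of `M` that is a single point or an open interval. -/
def IsPointOrInterval (s : Set M) : Prop :=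
  (∃ a, s = {a}) ∨ (∃ a b, s = Set.Ioo a b) ∨ (∃ a, s = Set.Ioi a) ∨
    (∃ a, s = Set.Iio a) ∨ s = Set.univ

/-- `M` (with the structure of `L` and the order `<`) is an o-minimal structure:
a structure on a dense linear order without endpoints, whose order is definable,
such that every definable subset of `M` is a finite union of points and open intervals. -/
def OMinimal : Prop :=
  DenselyOrdered M ∧ NoMinOrder M ∧ NoMaxOrder M ∧ Nonempty M ∧
    Defin L M {x : Fin 2 → M | x 0 < x 1} ∧
    ∀ s : Set M, Defin L M {x : Fin 1 → M | x 0 ∈ s} →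
      ∃ (n : ℕ) (t : Fin n → Set M), (∀ i, IsPointOrInterval M (t i)) ∧ s = ⋃ i, t i

/-- The order topology on `M`. -/
def otop : TopologicalSpace M := Preorder.topology M

/-- The product of the order topology on tuples. -/
def ptop (k : ℕ) : TopologicalSpace (Fin k → M) :=
  @Pi.topologicalSpace (Fin k) (fun _ => M) (fun _ => otop M)

/-- A definable set `S` is definably connected iff it is not the union of two disjoint
nonempty definable subsets that are open in `S`. -/
def DefConnected {k : ℕ} (S : Set (Fin k → M)) : Prop :=
  ∀ U V : Set (Fin k → M), Defin L M U → Defin L M V →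
    (∃ U', @IsOpen _ (ptop M k) U' ∧ U = U' ∩ S) →
    (∃ V', @IsOpen _ (ptop M k) V' ∧ V = V' ∩ S) →
    U ∪ V = S → U ∩ V = ∅ → (U = ∅ ∨ V = ∅)

/-- `X ⊆ M^k` has dimension at least `n`: some coordinate projection to `M^n` of `X`
has nonempty interior. -/
def DimGE {k : ℕ} (X : Set (Fin k → M)) (n : ℕ) : Prop :=
  ∃ f : Fin n → Fin k, Function.Injective f ∧
    (@interior _ (ptop M n) ((fun x : Fin k → M => x ∘ f) '' X)).Nonempty

/-- `X` has dimension exactly `n`: `n` is the largest integer such that the image of `X`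
under some coordinate projection `M^k → M^n` has nonempty interior. -/
def DimEq {k : ℕ} (X : Set (Fin k → M)) (n : ℕ) : Prop :=
  DimGE M X n ∧ ∀ m : ℕ, DimGE M X m → m ≤ n

end Order

/-- A definable abelian group: a definable set with definable group operations. -/
structure DefAbGroup where
  k : ℕ
  carrier : Set (Fin k → M)
  zero : Fin k → M
  add : (Fin k → M) → (Fin k → M) → (Fin k → M)
  neg : (Fin k → M) → (Fin k → M)
  zero_mem : zero ∈ carrier
  add_mem : ∀ x ∈ carrier, ∀ y ∈ carrier, add x y ∈ carrier
  neg_mem : ∀ x ∈ carrier, neg x ∈ carrier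
  hadd_assoc : ∀ x ∈ carrier, ∀ y ∈ carrier, ∀ z ∈ carrier,
    add (add x y) z = add x (add y z)
  hadd_comm : ∀ x ∈ carrier, ∀ y ∈ carrier, add x y = add y x
  hzero_add : ∀ x ∈ carrier, add zero x = x
  hneg_add : ∀ x ∈ carrier, add (neg x) x = zero
  carrier_def : Defin L M carrier
  add_def : Defin L M {p : (Fin k ⊕ Fin k ⊕ Fin k) → M |
    (fun i => p (Sum.inl i)) ∈ carrier ∧ (fun i => p (Sum.inr (Sum.inl i))) ∈ carrier ∧
    add (fun i => p (Sum.inl i)) (fun i => p (Sum.inr (Sum.inl i))) =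
      fun i => p (Sum.inr (Sum.inr i))}
  neg_def : Defin L M {p : (Fin k ⊕ Fin k) → M |
    (fun i => p (Sum.inl i)) ∈ carrier ∧
    neg (fun i => p (Sum.inl i)) = fun i => p (Sum.inr i)}

/-- A definable (not necessarily unital or commutative) ring: a definable abelian group
together with a definable associative multiplication distributing over the addition. -/
structure DefRing extends DefAbGroup L M where
  mul : (Fin k → M) → (Fin k → M) → (Fin k → M)
  mul_mem : ∀ x ∈ carrier, ∀ y ∈ carrier, mul x y ∈ carrier
  hmul_assoc : ∀ x ∈ carrier, ∀ y ∈ carrier, ∀ z ∈ carrier,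
    mul (mul x y) z = mul x (mul y z)
  hleft_distrib : ∀ x ∈ carrier, ∀ y ∈ carrier, ∀ z ∈ carrier,
    mul x (add y z) = add (mul x y) (mul x z)
  hright_distrib : ∀ x ∈ carrier, ∀ y ∈ carrier, ∀ z ∈ carrier,
    mul (add x y) z = add (mul x z) (mul y z)
  mul_def : Defin L M {p : (Fin k ⊕ Fin k ⊕ Fin k) → M |
    (fun i => p (Sum.inl i)) ∈ carrier ∧ (fun i => p (Sum.inr (Sum.inl i))) ∈ carrier ∧
    mul (fun i => p (Sum.inl i)) (fun i => p (Sum.inr (Sum.inl i))) =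
      fun i => p (Sum.inr (Sum.inr i))}

end OMin
namespace OMin

namespace DefAbGroup

variable {L : FirstOrder.Language} {M : Type} [L.Structure M] (G : DefAbGroup L M)

/-- `n • x` in the group `G`. -/
def nsmul : ℕ → (Fin G.k → M) → (Fin G.k → M)
  | 0, _ => G.zero
  | n + 1, x => G.add x (nsmul n x)

/-- Sum of a list of elements. -/
def listSum : List (Fin G.k → M) → (Fin G.k → M)
  | [] => G.zero
  | x :: l => G.add x (listSum l)

/-- Sum of a finitely indexed family of elements. -/
noncomputable def univSum {ι : Type} [Fintype ι] (f : ι → (Fin G.k → M)) : Fin G.k → M :=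
  G.listSum ((Finset.univ : Finset ι).toList.map f)

/-- `S` is a subgroup of `G`. -/
def IsSubgroup (S : Set (Fin G.k → M)) : Prop :=
  S ⊆ G.carrier ∧ G.zero ∈ S ∧ (∀ x ∈ S, ∀ y ∈ S, G.add x y ∈ S) ∧ ∀ x ∈ S, G.neg x ∈ S

/-- The `n`-torsion subgroup `{x : n • x = 0}`. -/
def torsion (n : ℕ) : Set (Fin G.k → M) :=
  {x | x ∈ G.carrier ∧ G.nsmul n x = G.zero}

/-- The elements of `S` have no (nontrivial) torsion. -/
def TorsionFreeOn (S : Set (Fin G.k → M)) : Prop :=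
  ∀ x ∈ S, ∀ n : ℕ, G.nsmul (n + 1) x = G.zero → x = G.zero

/-- The group `G` is torsion-free. -/
def TorsionFree : Prop := G.TorsionFreeOn G.carrier

/-- The set `S` is the internal direct sum of the family `I` of subgroups of `G`:
every element of `S` is uniquely the sum of a family of elements of the `I i`. -/
def IsInternalDirectSumOn {ι : Type} [Fintype ι] (S : Set (Fin G.k → M))
    (I : ι → Set (Fin G.k → M)) : Prop :=
  (∀ i, G.IsSubgroup (I i) ∧ I i ⊆ S) ∧
  (∀ x ∈ S, ∃ f : ι → (Fin G.k → M), (∀ i, f i ∈ I i) ∧ G.univSum f = x) ∧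
  (∀ f g : ι → (Fin G.k → M), (∀ i, f i ∈ I i) → (∀ i, g i ∈ I i) →
    G.univSum f = G.univSum g → f = g)

/-- `G` is the internal direct sum of the family `I` of subgroups. -/
def IsInternalDirectSum {ι : Type} [Fintype ι] (I : ι → Set (Fin G.k → M)) : Prop :=
  G.IsInternalDirectSumOn G.carrier I

section Order

variable [LinearOrder M]

/-- `C` is the definably connected component of `0` in `G`, i.e. the largest
definably connected definable subgroup of `G`. -/
def IsZeroComponent (C : Set (Fin G.k → M)) : Prop :=
  G.IsSubgroup C ∧ Defin L M C ∧ DefConnected L M C ∧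
    ∀ D, G.IsSubgroup D → Defin L M D → DefConnected L M D → D ⊆ C

/-- `N` is the maximal definable torsion-free subgroup of `G`. -/
def IsMaxDefTorsionFree (N : Set (Fin G.k → M)) : Prop :=
  G.IsSubgroup N ∧ Defin L M N ∧ G.TorsionFreeOn N ∧
    ∀ D, G.IsSubgroup D → Defin L M D → G.TorsionFreeOn D → D ⊆ N

end Order

end DefAbGroup

namespace DefRing

variable {L : FirstOrder.Language} {M : Type} [L.Structure M] (R : DefRing L M)

/-- `R` is a null ring: all products vanish. -/
def IsNull : Prop := ∀ x ∈ R.carrier, ∀ y ∈ R.carrier, R.mul x y = R.zero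

/-- The multiplication of `R` restricted to `S` is trivial. -/
def NullOn (S : Set (Fin R.k → M)) : Prop := ∀ x ∈ S, ∀ y ∈ S, R.mul x y = R.zero

/-- The two-sided annihilator of `X` in `R`. -/
def annOf (X : Set (Fin R.k → M)) : Set (Fin R.k → M) :=
  {a | a ∈ R.carrier ∧ ∀ x ∈ X, R.mul a x = R.zero ∧ R.mul x a = R.zero}

/-- `Ann(R)`, the two-sided annihilator of `R`. -/
def ann : Set (Fin R.k → M) := R.annOf R.carrier

/-- `powSucc x n = x^(n+1)`. -/
def powSucc (x : Fin R.k → M) : ℕ → (Fin R.k → M)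
  | 0 => x
  | n + 1 => R.mul (powSucc x n) x

/-- `upow e x n = x^n`, where `x^0 = e` (for a unital ring with identity `e`). -/
def upow (e x : Fin R.k → M) : ℕ → (Fin R.k → M)
  | 0 => e
  | n + 1 => R.mul (upow e x n) x

/-- `products S n` is the set of all products of `n` elements of `S` (for `n ≥ 1`;
by convention `products S 0 = {0}`). -/
def products (S : Set (Fin R.k → M)) : ℕ → Set (Fin R.k → M)
  | 0 => {R.zero}
  | 1 => S
  | n + 2 => {z | ∃ x ∈ S, ∃ y ∈ products S (n + 1), z = R.mul x y}

/-- `R` is a nilpotent ring: all products of some fixed length vanish. -/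
def IsNilpotentRing : Prop := ∃ m, 1 ≤ m ∧ R.products R.carrier m = {R.zero}

/-- `R` is a nil ring: every element is nilpotent. -/
def IsNilRing : Prop := ∀ x ∈ R.carrier, ∃ m : ℕ, R.powSucc x m = R.zero

/-- The set `I` is nilpotent: all products of some fixed length of elements of `I` vanish. -/
def NilpotentSet (I : Set (Fin R.k → M)) : Prop := ∃ m, 1 ≤ m ∧ R.products I m = {R.zero}

/-- `I` is a left ideal of `R`. -/
def IsLeftIdeal (I : Set (Fin R.k → M)) : Prop :=
  R.IsSubgroup I ∧ ∀ r ∈ R.carrier, ∀ x ∈ I, R.mul r x ∈ I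

/-- `I` is a right ideal of `R`. -/
def IsRightIdeal (I : Set (Fin R.k → M)) : Prop :=
  R.IsSubgroup I ∧ ∀ r ∈ R.carrier, ∀ x ∈ I, R.mul x r ∈ I

/-- `I` is a two-sided ideal of `R`. -/
def IsIdeal (I : Set (Fin R.k → M)) : Prop :=
  R.IsSubgroup I ∧ ∀ r ∈ R.carrier, ∀ x ∈ I, R.mul r x ∈ I ∧ R.mul x r ∈ I

/-- The Jacobson radical of `R`:
`J(R) = {a ∈ R : ∀ r ∈ R, ∃ b ∈ R, b·r·a − r·a − b = 0}`. -/
def jacobson : Set (Fin R.k → M) :=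
  {a | a ∈ R.carrier ∧ ∀ r ∈ R.carrier, ∃ b ∈ R.carrier,
    R.add (R.mul (R.mul b r) a) (R.add (R.neg (R.mul r a)) (R.neg b)) = R.zero}

/-- `R` is semiprime: `{0}` is its only nilpotent two-sided ideal. -/
def IsSemiprime : Prop := ∀ I, R.IsIdeal I → R.NilpotentSet I → I = {R.zero}

/-- `R` is prime: `aRb ≠ {0}` whenever `a, b ≠ 0`. -/
def IsPrimeRing : Prop := ∀ a ∈ R.carrier, a ≠ R.zero → ∀ b ∈ R.carrier, b ≠ R.zero →
    ∃ r ∈ R.carrier, R.mul (R.mul a r) b ≠ R.zero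

/-- `R` is simple: nontrivial multiplication and no nontrivial proper two-sided ideals. -/
def IsSimple : Prop := (¬ R.IsNull) ∧ ∀ I, R.IsIdeal I → I = {R.zero} ∨ I = R.carrier

/-- `R` is definably simple: nontrivial multiplication and no nontrivial proper
*definable* two-sided ideals. -/
def IsDefSimple : Prop :=
  (¬ R.IsNull) ∧ ∀ I, R.IsIdeal I → Defin L M I → I = {R.zero} ∨ I = R.carrier

/-- `e` is a (two-sided) multiplicative identity of `R`. -/
def IsIdentity (e : Fin R.k → M) : Prop :=
  e ∈ R.carrier ∧ ∀ x ∈ R.carrier, R.mul e x = x ∧ R.mul x e = x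

/-- `R` is unital. -/
def IsUnital : Prop := ∃ e, R.IsIdentity e

/-- `R` is a division ring. -/
def IsDivisionRing : Prop :=
  ∃ e, R.IsIdentity e ∧ e ≠ R.zero ∧ ∀ x ∈ R.carrier, x ≠ R.zero →
    ∃ y ∈ R.carrier, R.mul x y = e ∧ R.mul y x = e

theorem IsDivisionRing.unital {R : DefRing L M} (h : R.IsDivisionRing) : R.IsUnital :=
  h.imp fun _ he => he.1

/-- `S` is a subring (as a subset, not necessarily definable). -/
def IsSubringSet (S : Set (Fin R.k → M)) : Prop :=
  S ⊆ R.carrier ∧ R.zero ∈ S ∧ (∀ x ∈ S, ∀ y ∈ S, R.add x y ∈ S) ∧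
    (∀ x ∈ S, R.neg x ∈ S) ∧ ∀ x ∈ S, ∀ y ∈ S, R.mul x y ∈ S

/-- `S` is a definable subring of `R`. -/
def IsDefSubring (S : Set (Fin R.k → M)) : Prop :=
  Defin L M S ∧ R.IsSubringSet S

/-- `S` is the smallest definable subring of `R` containing `x`. -/
def IsSmallestDefSubringContaining (x : Fin R.k → M) (S : Set (Fin R.k → M)) : Prop :=
  R.IsDefSubring S ∧ x ∈ S ∧ ∀ T, R.IsDefSubring T → x ∈ T → S ⊆ T

/-- `e` is an idempotent element of `R`. -/
def IsIdempotent (e : Fin R.k → M) : Prop := e ∈ R.carrier ∧ R.mul e e = e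

/-- `a` and `b` are orthogonal: `a·b = b·a = 0`. -/
def Orthogonal (a b : Fin R.k → M) : Prop := R.mul a b = R.zero ∧ R.mul b a = R.zero

/-- `e` is a primitive idempotent: a nonzero idempotent that is not the sum of two
nonzero orthogonal idempotents. -/
def IsPrimitiveIdempotent (e : Fin R.k → M) : Prop :=
  R.IsIdempotent e ∧ e ≠ R.zero ∧
    ¬ ∃ a b, R.IsIdempotent a ∧ R.IsIdempotent b ∧ a ≠ R.zero ∧ b ≠ R.zero ∧
      R.Orthogonal a b ∧ R.add a b = e

/-- The set `R·e`. -/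
def leftMulSet (e : Fin R.k → M) : Set (Fin R.k → M) :=
  {z | ∃ r ∈ R.carrier, z = R.mul r e}

/-- The set `e·R`. -/
def rightMulSet (e : Fin R.k → M) : Set (Fin R.k → M) :=
  {z | ∃ r ∈ R.carrier, z = R.mul e r}

/-- The set `e·R·f`. -/
def midMulSet (e f : Fin R.k → M) : Set (Fin R.k → M) :=
  {z | ∃ r ∈ R.carrier, z = R.mul e (R.mul r f)}

/-- `I` is a minimal left ideal. -/
def IsMinimalLeftIdeal (I : Set (Fin R.k → M)) : Prop :=
  R.IsLeftIdeal I ∧ I ≠ {R.zero} ∧ ∀ J, R.IsLeftIdeal J → J ⊆ I → J = {R.zero} ∨ J = I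

/-- `I` is a minimal right ideal. -/
def IsMinimalRightIdeal (I : Set (Fin R.k → M)) : Prop :=
  R.IsRightIdeal I ∧ I ≠ {R.zero} ∧ ∀ J, R.IsRightIdeal J → J ⊆ I → J = {R.zero} ∨ J = I

/-- `R` is left Artinian: every descending chain of left ideals stabilizes. -/
def LeftArtinian : Prop :=
  ∀ f : ℕ → Set (Fin R.k → M), (∀ n, R.IsLeftIdeal (f n)) → (∀ n, f (n + 1) ⊆ f n) →
    ∃ N, ∀ n, N ≤ n → f n = f N

/-- `J` is a two-sided ideal of the (sub)ring `S`. -/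
def IsIdealOn (S J : Set (Fin R.k → M)) : Prop :=
  J ⊆ S ∧ R.zero ∈ J ∧ (∀ x ∈ J, ∀ y ∈ J, R.add x y ∈ J) ∧ (∀ x ∈ J, R.neg x ∈ J) ∧
    ∀ r ∈ S, ∀ x ∈ J, R.mul r x ∈ J ∧ R.mul x r ∈ J

/-- The (sub)ring `S` is a simple ring. -/
def SimpleOn (S : Set (Fin R.k → M)) : Prop :=
  (¬ R.NullOn S) ∧ ∀ J, R.IsIdealOn S J → J = {R.zero} ∨ J = S

/-- The (sub)ring `S` is a division ring. -/
def DivisionOn (S : Set (Fin R.k → M)) : Prop :=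
  ∃ e ∈ S, e ≠ R.zero ∧ (∀ x ∈ S, R.mul e x = x ∧ R.mul x e = x) ∧
    ∀ x ∈ S, x ≠ R.zero → ∃ y ∈ S, R.mul x y = e ∧ R.mul y x = e

/-- `R` is a (commutative) field. -/
def IsFieldRing : Prop :=
  (∀ x ∈ R.carrier, ∀ y ∈ R.carrier, R.mul x y = R.mul y x) ∧
  ∃ e, R.IsIdentity e ∧ e ≠ R.zero ∧
    ∀ x ∈ R.carrier, x ≠ R.zero → ∃ y ∈ R.carrier, R.mul x y = e

/-- Evaluation of the polynomial `∑_{i ≤ n} c i * X^i` at `x` (`e` the identity). -/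
def polyEval (e x : Fin R.k → M) (c : ℕ → (Fin R.k → M)) (n : ℕ) : Fin R.k → M :=
  R.listSum ((List.range (n + 1)).map fun i => R.mul (c i) (R.upow e x i))

/-- `R` is a real closed field: a field together with a linear order making it an
ordered field in which nonnegative elements are squares and every odd-degree polynomial
has a root. -/
def IsRealClosedDefField : Prop :=
  R.IsFieldRing ∧
  ∃ e, R.IsIdentity e ∧
  ∃ lt : (Fin R.k → M) → (Fin R.k → M) → Prop,
    (∀ x ∈ R.carrier, ¬ lt x x) ∧
    (∀ x ∈ R.carrier, ∀ y ∈ R.carrier, ∀ z ∈ R.carrier, lt x y → lt y z → lt x z) ∧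
    (∀ x ∈ R.carrier, ∀ y ∈ R.carrier, x ≠ y → lt x y ∨ lt y x) ∧
    (∀ x ∈ R.carrier, ∀ y ∈ R.carrier, ∀ z ∈ R.carrier, lt x y →
      lt (R.add x z) (R.add y z)) ∧
    (∀ x ∈ R.carrier, ∀ y ∈ R.carrier, lt R.zero x → lt R.zero y → lt R.zero (R.mul x y)) ∧
    (∀ x ∈ R.carrier, ¬ lt x R.zero → ∃ y ∈ R.carrier, R.mul y y = x) ∧
    (∀ n : ℕ, Odd n → ∀ c : ℕ → (Fin R.k → M), (∀ i, i ≤ n → c i ∈ R.carrier) →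
      c n ≠ R.zero → ∃ x ∈ R.carrier, R.polyEval e x c n = R.zero)

end DefRing

/-- A definable isomorphism of definable rings: a ring isomorphism whose graph is
definable. -/
def DefIso {L : FirstOrder.Language} {M : Type} [L.Structure M] (A B : DefRing L M) : Prop :=
  ∃ f : (Fin A.k → M) → (Fin B.k → M),
    Set.BijOn f A.carrier B.carrier ∧
    (∀ x ∈ A.carrier, ∀ y ∈ A.carrier,
      f (A.add x y) = B.add (f x) (f y) ∧ f (A.mul x y) = B.mul (f x) (f y)) ∧
    Defin L M {p : (Fin A.k ⊕ Fin B.k) → M |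
      (fun i => p (Sum.inl i)) ∈ A.carrier ∧
      f (fun i => p (Sum.inl i)) = fun i => p (Sum.inr i)}

end OMin
namespace OMin

/-- The language of rings with only the two binary operations `+` and `·`. -/
def ringLang : FirstOrder.Language :=
  ⟨fun n => match n with | 2 => Bool | _ => Empty, fun _ => Empty⟩

namespace DefRing

variable {L : FirstOrder.Language} {M : Type} [L.Structure M] (R : DefRing L M)

/-- The ring structure `(R, +, ·)` as a first-order structure on the carrier of `R`. -/
def innerStr : ringLang.Structure ↥R.carrier where
  funMap {n} f x :=
    match n, f, x with
    | 2, b, x =>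
      if (show Bool from b) then ⟨R.add ↑(x 0) ↑(x 1), R.add_mem _ (x 0).2 _ (x 1).2⟩
      else ⟨R.mul ↑(x 0) ↑(x 1), R.mul_mem _ (x 0).2 _ (x 1).2⟩
    | 0, f, _ => f.elim
    | 1, f, _ => f.elim
    | _ + 3, f, _ => f.elim
  RelMap {n} r _ := r.elim

/-- A set of tuples from the carrier of `R` that is definable in the pure ring
structure `(R, +, ·)`. -/
def InnerDefinable {α : Type} (S : Set (α → ↥R.carrier)) : Prop :=
  letI := R.innerStr
  Set.Definable (Set.univ : Set ↥R.carrier) ringLang S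

/-- A subset of `R` that is definable in the pure ring structure `(R, +, ·)`. -/
def InnerDefinableSubset (S : Set (Fin R.k → M)) : Prop :=
  S ⊆ R.carrier ∧
    R.InnerDefinable {x : Fin 1 → ↥R.carrier | ((x 0 : ↥R.carrier) : Fin R.k → M) ∈ S}

variable {R}

theorem add_zero' {x : Fin R.k → M} (hx : x ∈ R.carrier) : R.add x R.zero = x := by
  rw [R.hadd_comm x hx R.zero R.zero_mem]; exact R.hzero_add x hx

theorem add_neg' {x : Fin R.k → M} (hx : x ∈ R.carrier) : R.add x (R.neg x) = R.zero := by
  rw [R.hadd_comm x hx (R.neg x) (R.neg_mem x hx)]; exact R.hneg_add x hx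

theorem add_left_cancel' {a b c : Fin R.k → M}
    (ha : a ∈ R.carrier) (hb : b ∈ R.carrier) (hc : c ∈ R.carrier)
    (h : R.add a b = R.add a c) : b = c := by
  have hna := R.neg_mem a ha
  calc b = R.add R.zero b := (R.hzero_add b hb).symm
    _ = R.add (R.add (R.neg a) a) b := by rw [R.hneg_add a ha]
    _ = R.add (R.neg a) (R.add a b) := R.hadd_assoc _ hna _ ha _ hb
    _ = R.add (R.neg a) (R.add a c) := by rw [h]
    _ = R.add (R.add (R.neg a) a) c := (R.hadd_assoc _ hna _ ha _ hc).symm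
    _ = R.add R.zero c := by rw [R.hneg_add a ha]
    _ = c := R.hzero_add c hc

theorem zero_mul' {x : Fin R.k → M} (hx : x ∈ R.carrier) : R.mul R.zero x = R.zero := by
  have h0 := R.zero_mem
  have hm := R.mul_mem _ h0 _ hx
  apply add_left_cancel' hm hm h0
  calc R.add (R.mul R.zero x) (R.mul R.zero x)
      = R.mul (R.add R.zero R.zero) x := (R.hright_distrib _ h0 _ h0 _ hx).symm
    _ = R.mul R.zero x := by rw [R.hzero_add _ h0]
    _ = R.add (R.mul R.zero x) R.zero := (add_zero' hm).symm

theorem mul_zero' {x : Fin R.k → M} (hx : x ∈ R.carrier) : R.mul x R.zero = R.zero := by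
  have h0 := R.zero_mem
  have hm := R.mul_mem _ hx _ h0
  apply add_left_cancel' hm hm h0
  calc R.add (R.mul x R.zero) (R.mul x R.zero)
      = R.mul x (R.add R.zero R.zero) := (R.hleft_distrib _ hx _ h0 _ h0).symm
    _ = R.mul x R.zero := by rw [R.hzero_add _ h0]
    _ = R.add (R.mul x R.zero) R.zero := (add_zero' hm).symm

variable (R)

/-- The addition on the carrier of a definable ring. -/
def addSub : Add ↥R.carrier := ⟨fun a b => ⟨R.add a b, R.add_mem _ a.2 _ b.2⟩⟩

/-- The zero of the carrier of a definable ring. -/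
def zeroSub : Zero ↥R.carrier := ⟨⟨R.zero, R.zero_mem⟩⟩

/-- The negation on the carrier of a definable ring. -/
def negSub : Neg ↥R.carrier := ⟨fun a => ⟨R.neg a, R.neg_mem _ a.2⟩⟩

/-- The unital ring structure on the carrier of a unital definable ring. -/
noncomputable def ringSub (h : R.IsUnital) : Ring ↥R.carrier := by
  letI := R.addSub; letI := R.zeroSub; letI := R.negSub
  exact
  { add := fun a b => ⟨R.add a b, R.add_mem _ a.2 _ b.2⟩
    add_assoc := fun a b c => Subtype.ext (R.hadd_assoc _ a.2 _ b.2 _ c.2)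
    zero := ⟨R.zero, R.zero_mem⟩
    zero_add := fun a => Subtype.ext (R.hzero_add _ a.2)
    add_zero := fun a => Subtype.ext (add_zero' a.2)
    add_comm := fun a b => Subtype.ext (R.hadd_comm _ a.2 _ b.2)
    neg := fun a => ⟨R.neg a, R.neg_mem _ a.2⟩
    neg_add_cancel := fun a => Subtype.ext (R.hneg_add _ a.2)
    nsmul := nsmulRec
    zsmul := zsmulRec
    mul := fun a b => ⟨R.mul a b, R.mul_mem _ a.2 _ b.2⟩
    mul_assoc := fun a b c => Subtype.ext (R.hmul_assoc _ a.2 _ b.2 _ c.2)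
    one := ⟨Classical.choose h, (Classical.choose_spec h).1⟩
    one_mul := fun a => Subtype.ext (((Classical.choose_spec h).2 _ a.2).1)
    mul_one := fun a => Subtype.ext (((Classical.choose_spec h).2 _ a.2).2)
    left_distrib := fun a b c => Subtype.ext (R.hleft_distrib _ a.2 _ b.2 _ c.2)
    right_distrib := fun a b c => Subtype.ext (R.hright_distrib _ a.2 _ b.2 _ c.2)
    zero_mul := fun a => Subtype.ext (zero_mul' a.2)
    mul_zero := fun a => Subtype.ext (mul_zero' a.2)
    nsmul_zero := fun a => rfl
    nsmul_succ := fun n a => rfl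
    zsmul_zero' := fun a => rfl
    zsmul_succ' := fun n a => rfl
    zsmul_neg' := fun n a => rfl }

theorem IsFieldRing.unital {R : DefRing L M} (h : R.IsFieldRing) : R.IsUnital :=
  h.2.imp fun _ he => he.1

/-- The commutative ring structure on the carrier of a definable field. -/
noncomputable def commRingSub (h : R.IsFieldRing) : CommRing ↥R.carrier :=
  { R.ringSub h.unital with
    mul_comm := fun a b => by exact Subtype.ext (h.1 _ a.2 _ b.2) }

end DefRing

end OMin
namespace OMin

/-- `K(√-1)`: the quadratic extension `K[X]/(X² + 1)` of `K`, realized concretely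
on pairs. -/
structure Gauss (K : Type) where
  re : K
  im : K

namespace Gauss

variable {K : Type} [CommRing K]

@[ext] theorem ext {a b : Gauss K} (h1 : a.re = b.re) (h2 : a.im = b.im) : a = b := by
  cases a; cases b; cases h1; cases h2; rfl

instance : Add (Gauss K) := ⟨fun a b => ⟨a.re + b.re, a.im + b.im⟩⟩
instance : Mul (Gauss K) := ⟨fun a b => ⟨a.re * b.re - a.im * b.im, a.re * b.im + a.im * b.re⟩⟩
instance : Neg (Gauss K) := ⟨fun a => ⟨-a.re, -a.im⟩⟩
instance : Zero (Gauss K) := ⟨⟨0, 0⟩⟩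
instance : One (Gauss K) := ⟨⟨1, 0⟩⟩

@[simp] theorem add_re (a b : Gauss K) : (a + b).re = a.re + b.re := rfl
@[simp] theorem add_im (a b : Gauss K) : (a + b).im = a.im + b.im := rfl
@[simp] theorem mul_re (a b : Gauss K) : (a * b).re = a.re * b.re - a.im * b.im := rfl
@[simp] theorem mul_im (a b : Gauss K) : (a * b).im = a.re * b.im + a.im * b.re := rfl
@[simp] theorem neg_re (a : Gauss K) : (-a).re = -a.re := rfl
@[simp] theorem neg_im (a : Gauss K) : (-a).im = -a.im := rfl
@[simp] theorem zero_re : (0 : Gauss K).re = 0 := rfl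
@[simp] theorem zero_im : (0 : Gauss K).im = 0 := rfl
@[simp] theorem one_re : (1 : Gauss K).re = 1 := rfl
@[simp] theorem one_im : (1 : Gauss K).im = 0 := rfl

instance : CommRing (Gauss K) where
  add := (· + ·)
  add_assoc a b c := by ext <;> simp <;> ring
  zero := 0
  zero_add a := by ext <;> simp
  add_zero a := by ext <;> simp
  add_comm a b := by ext <;> simp <;> ring
  neg := Neg.neg
  neg_add_cancel a := by ext <;> simp
  nsmul := nsmulRec
  zsmul := zsmulRec
  mul := (· * ·)
  mul_assoc a b c := by ext <;> simp <;> ring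
  one := 1
  one_mul a := by ext <;> simp
  mul_one a := by ext <;> simp
  left_distrib a b c := by ext <;> simp <;> ring
  right_distrib a b c := by ext <;> simp <;> ring
  zero_mul a := by ext <;> simp
  mul_zero a := by ext <;> simp
  mul_comm a b := by ext <;> simp <;> ring

end Gauss

variable {L : FirstOrder.Language} {M : Type} [L.Structure M]

/-- An abstract field `F` isomorphic (as a ring, via `iso`) to the definable field `K`,
together with a finite-dimensional associative `F`-algebra `A` with nontrivial
multiplication and a (set-level) ring isomorphism `aiso` from the subring `S` of the
definable ring `R` onto `A`. -/
structure AlgebraCopy (K : DefRing L M) (R : DefRing L M) (S : Set (Fin R.k → M)) where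
  F : Type
  [fieldF : Field F]
  iso : (Fin K.k → M) → F
  bij : Set.BijOn iso K.carrier Set.univ
  map_add : ∀ x ∈ K.carrier, ∀ y ∈ K.carrier, iso (K.add x y) = iso x + iso y
  map_mul : ∀ x ∈ K.carrier, ∀ y ∈ K.carrier, iso (K.mul x y) = iso x * iso y
  A : Type
  [ringA : NonUnitalRing A]
  [moduleA : Module F A]
  [towerA : IsScalarTower F A A]
  [commA : SMulCommClass F A A]
  findim : FiniteDimensional F A
  notNull : ∃ a b : A, a * b ≠ 0
  aiso : (Fin R.k → M) → A
  abij : Set.BijOn aiso S Set.univ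
  amap_add : ∀ x ∈ S, ∀ y ∈ S, aiso (R.add x y) = aiso x + aiso y
  amap_mul : ∀ x ∈ S, ∀ y ∈ S, aiso (R.mul x y) = aiso x * aiso y

/-- The (abstract) ring `A` has nontrivial multiplication, i.e. is not a null ring. -/
def NotNullCarrier (A : Type) [NonUnitalRing A] : Prop := ∃ a b : A, a * b ≠ 0

/-- A finite-dimensional associative `F`-algebra `A` and a ring isomorphism from the
definable ring `R` onto the direct product `A × B`, for a definable ring `B`. -/
structure ProdSplit (F : Type) [Field F] (R : DefRing L M) (B : DefRing L M) where
  A : Type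
  [ringA : NonUnitalRing A]
  [moduleA : Module F A]
  [towerA : IsScalarTower F A A]
  [commA : SMulCommClass F A A]
  findim : FiniteDimensional F A
  f : (Fin R.k → M) → A × (Fin B.k → M)
  bij : Set.BijOn f R.carrier {p | p.2 ∈ B.carrier}
  map_add : ∀ x ∈ R.carrier, ∀ y ∈ R.carrier,
    f (R.add x y) = ((f x).1 + (f y).1, B.add (f x).2 (f y).2)
  map_mul : ∀ x ∈ R.carrier, ∀ y ∈ R.carrier,
    f (R.mul x y) = ((f x).1 * (f y).1, B.mul (f x).2 (f y).2)

/-- `D` (a definable ring in `M`) is a copy, via the canonical flattening of tuples,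
of the ring `Din`, which is definable in the pure ring structure `(B, +, ·)`. -/
def IsInnerCopy (B : DefRing L M) (Din : @DefRing ringLang ↥B.carrier B.innerStr)
    (D : DefRing L M) : Prop :=
  letI := B.innerStr
  ∃ e : Fin D.k ≃ (Fin Din.k × Fin B.k),
    ∃ g : (Fin Din.k → ↥B.carrier) → (Fin D.k → M),
      (∀ x i, g x i = (x (e i).1 : Fin B.k → M) (e i).2) ∧
      Set.BijOn g Din.carrier D.carrier ∧
      ∀ x ∈ Din.carrier, ∀ y ∈ Din.carrier,
        g (Din.add x y) = D.add (g x) (g y) ∧ g (Din.mul x y) = D.mul (g x) (g y)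

/-- `R` is definably isomorphic to the ring `M_n(D)` of `n × n` matrices over the
definable division ring `D`. -/
def MatrixIso (R D : DefRing L M) (hD : D.IsUnital) (n : ℕ) : Prop :=
  letI := D.ringSub hD
  ∃ f : (Fin R.k → M) → Matrix (Fin n) (Fin n) ↥D.carrier,
    Set.BijOn f R.carrier Set.univ ∧
    (∀ x ∈ R.carrier, ∀ y ∈ R.carrier,
      f (R.add x y) = f x + f y ∧ f (R.mul x y) = f x * f y) ∧
    Defin L M {p : (Fin R.k ⊕ Fin n × Fin n × Fin D.k) → M |
      (fun i => p (Sum.inl i)) ∈ R.carrier ∧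
      ∀ q : Fin n × Fin n × Fin D.k,
        ((f (fun i => p (Sum.inl i)) q.1 q.2.1 : ↥D.carrier) : Fin D.k → M) q.2.2 =
          p (Sum.inr q)}

/-- A definable scalar multiplication of the definable field `K` on the subset `S` of the
definable ring `R` making `S` a definable `K`-vector space. -/
def IsDefVectorSpaceOn (K R : DefRing L M) (S : Set (Fin R.k → M))
    (σ : (Fin K.k → M) → (Fin R.k → M) → (Fin R.k → M)) : Prop :=
  (∀ c ∈ K.carrier, ∀ x ∈ S, σ c x ∈ S) ∧
  Defin L M {p : (Fin K.k ⊕ Fin R.k ⊕ Fin R.k) → M |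
    (fun i => p (Sum.inl i)) ∈ K.carrier ∧ (fun i => p (Sum.inr (Sum.inl i))) ∈ S ∧
    σ (fun i => p (Sum.inl i)) (fun i => p (Sum.inr (Sum.inl i))) =
      fun i => p (Sum.inr (Sum.inr i))} ∧
  (∀ e, K.IsIdentity e → ∀ x ∈ S, σ e x = x) ∧
  (∀ c ∈ K.carrier, ∀ x ∈ S, ∀ y ∈ S, σ c (R.add x y) = R.add (σ c x) (σ c y)) ∧
  (∀ c ∈ K.carrier, ∀ d ∈ K.carrier, ∀ x ∈ S, σ (K.add c d) x = R.add (σ c x) (σ d x)) ∧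
  (∀ c ∈ K.carrier, ∀ d ∈ K.carrier, ∀ x ∈ S, σ (K.mul c d) x = σ c (σ d x))

/-- The subring `S` of `R` is a definable `K`-vector space and a definable associative
`K`-algebra. -/
def IsDefAlgebraOn (K R : DefRing L M) (S : Set (Fin R.k → M)) : Prop :=
  ∃ σ, IsDefVectorSpaceOn K R S σ ∧
    ∀ r ∈ K.carrier, ∀ s ∈ K.carrier, ∀ u ∈ S, ∀ v ∈ S,
      R.mul (σ r u) (σ s v) = σ (K.mul r s) (R.mul u v)

/-- `S` (a subring of the definable ring `R`) is definably isomorphic to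
`K^r × K(√-1)^p × ℍ(K)^q`, for the definable field `K`. -/
def GaussQuatIso (R : DefRing L M) (S : Set (Fin R.k → M)) (K : DefRing L M)
    (hK : K.IsFieldRing) (r p q : ℕ) : Prop :=
  letI := K.commRingSub hK
  ∃ f : (Fin R.k → M) →
      ((Fin r → ↥K.carrier) × (Fin p → Gauss ↥K.carrier) × (Fin q → Quaternion ↥K.carrier)),
    Set.BijOn f S Set.univ ∧
    (∀ x ∈ S, ∀ y ∈ S, f (R.add x y) = f x + f y ∧ f (R.mul x y) = f x * f y) ∧
    Defin L M {pp : (Fin R.k ⊕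
        ((Fin r × Fin K.k) ⊕ (Fin p × Fin 2 × Fin K.k) ⊕ (Fin q × Fin 4 × Fin K.k))) → M |
      (fun i => pp (Sum.inl i)) ∈ S ∧
      (∀ (a : Fin r) (c : Fin K.k),
        (((f (fun i => pp (Sum.inl i))).1 a : Fin K.k → M)) c =
          pp (Sum.inr (Sum.inl (a, c)))) ∧
      (∀ (a : Fin p) (c : Fin K.k),
        ((((f (fun i => pp (Sum.inl i))).2.1 a).re : Fin K.k → M)) c =
            pp (Sum.inr (Sum.inr (Sum.inl (a, 0, c)))) ∧
        ((((f (fun i => pp (Sum.inl i))).2.1 a).im : Fin K.k → M)) c =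
            pp (Sum.inr (Sum.inr (Sum.inl (a, 1, c))))) ∧
      (∀ (a : Fin q) (c : Fin K.k),
        ((((f (fun i => pp (Sum.inl i))).2.2 a).re : Fin K.k → M)) c =
            pp (Sum.inr (Sum.inr (Sum.inr (a, 0, c)))) ∧
        ((((f (fun i => pp (Sum.inl i))).2.2 a).imI : Fin K.k → M)) c =
            pp (Sum.inr (Sum.inr (Sum.inr (a, 1, c)))) ∧
        ((((f (fun i => pp (Sum.inl i))).2.2 a).imJ : Fin K.k → M)) c =
            pp (Sum.inr (Sum.inr (Sum.inr (a, 2, c)))) ∧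
        ((((f (fun i => pp (Sum.inl i))).2.2 a).imK : Fin K.k → M)) c =
            pp (Sum.inr (Sum.inr (Sum.inr (a, 3, c)))))}

end OMin
set_option linter.unusedSectionVars false

namespace OMin

section Definability

variable (L : FirstOrder.Language) (M : Type) [L.Structure M]

/-- A type whose elements are encoded by tuples from `M`, with definable range. -/
class Srt (X : Type) where
  /-- The index set of the encoding tuples. -/
  Idx : Type
  finite_idx : Finite Idx
  /-- The encoding. -/
  tuple : X → Idx → M
  tuple_injective : Function.Injective tuple
  defin_range : Defin L M (Set.range tuple)

attribute [instance] Srt.finite_idx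

/-- The index set of the tuples encoding the elements of `X`. -/
abbrev Idx (X : Type) [Srt L M X] : Type := Srt.Idx L M X

/-- The tuple encoding `x`. -/
abbrev enc {X : Type} [Srt L M X] (x : X) : Idx L M X → M := Srt.tuple x

variable {L M} in
theorem enc_injective {X : Type} [Srt L M X] {x y : X} (h : enc L M x = enc L M y) : x = y :=
  Srt.tuple_injective h

theorem defin_range (X : Type) [Srt L M X] : Defin L M (Set.range (enc L M (X := X))) :=
  Srt.defin_range

variable {X Y Z : Type} [Srt L M X] [Srt L M Y] [Srt L M Z]

/-- A map between sorts is definable if its graph is. -/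
@[fun_prop]
def Dfn (f : X → Y) : Prop :=
  Defin L M {z : Idx L M X ⊕ Idx L M Y → M |
    ∃ x, enc L M x = z ∘ Sum.inl ∧ enc L M (f x) = z ∘ Sum.inr}

variable {L M}

theorem Defin.reindex {α β : Type} {s : Set (α → M)} (hs : Defin L M s) (g : α → β) :
    Defin L M {z : β → M | z ∘ g ∈ s} :=
  Set.Definable.preimage_comp g hs

theorem Defin.and {α : Type} {p q : (α → M) → Prop} (hp : Defin L M {z | p z})
    (hq : Defin L M {z | q z}) : Defin L M {z | p z ∧ q z} :=
  Set.Definable.inter hp hq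

theorem Defin.ex {α β : Type} [Finite β] {p : (α ⊕ β → M) → Prop} (hp : Defin L M {z | p z}) :
    Defin L M {z : α → M | ∃ w : β → M, p (Sum.elim z w)} :=
  Set.Definable.exists_of_finite hp

theorem Defin.congr {α : Type} {p q : (α → M) → Prop} (hp : Defin L M {z | p z})
    (h : ∀ z, q z ↔ p z) : Defin L M {z | q z} := by
  rwa [show {z | q z} = {z | p z} from Set.ext h]

theorem Defin.eq {α : Type} (i j : α) : Defin L M {z : α → M | z i = z j} :=
  ⟨(FirstOrder.Language.Term.var i).equal (FirstOrder.Language.Term.var j), by ext; simp⟩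

theorem Defin.eq_const {α : Type} (i : α) (c : M) : Defin L M {z : α → M | z i = c} :=
  ⟨(FirstOrder.Language.Term.var i).equal (L.con (⟨c, trivial⟩ : (Set.univ : Set M))).term, by
    ext; simp⟩

theorem Defin.forall {α ι : Type} [Finite ι] {p : ι → (α → M) → Prop}
    (h : ∀ i, Defin L M {z | p i z}) : Defin L M {z | ∀ i, p i z} := by
  have := Set.definable_iInter_of_finite h
  exact Defin.congr this fun z => Set.mem_iInter.symm

theorem Defin.comp_eq {α ι : Type} [Finite ι] (f g : ι → α) :
    Defin L M {z : α → M | z ∘ f = z ∘ g} :=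
  Defin.congr (Defin.forall fun i => Defin.eq (L := L) (M := M) (f i) (g i)) fun _ =>
    funext_iff

theorem Defin.comp_eq_const {α ι : Type} [Finite ι] (f : ι → α) (c : ι → M) :
    Defin L M {z : α → M | z ∘ f = c} :=
  Defin.congr (Defin.forall fun i => Defin.eq_const (L := L) (M := M) (f i) (c i)) fun _ =>
    funext_iff

instance : Srt L M M where
  Idx := Unit
  finite_idx := inferInstance
  tuple m _ := m
  tuple_injective _ _ h := congrFun h ()
  defin_range := Defin.congr Set.definable_univ fun z => ⟨fun _ => trivial, fun _ => ⟨z (), rfl⟩⟩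

instance {k : ℕ} : Srt L M (Fin k → M) where
  Idx := Fin k
  finite_idx := inferInstance
  tuple m := m
  tuple_injective _ _ h := h
  defin_range := Defin.congr Set.definable_univ fun z => ⟨fun _ => trivial, fun _ => ⟨z, rfl⟩⟩

instance : Srt L M (X × Y) where
  Idx := Idx L M X ⊕ Idx L M Y
  finite_idx := inferInstance
  tuple p := Sum.elim (enc L M p.1) (enc L M p.2)
  tuple_injective _ _ h := by
    have h1 := congrArg (· ∘ Sum.inl) h
    have h2 := congrArg (· ∘ Sum.inr) h
    simp only [Sum.elim_comp_inl, Sum.elim_comp_inr] at h1 h2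
    exact Prod.ext (enc_injective h1) (enc_injective h2)
  defin_range := by
    refine Defin.congr (Defin.and ((defin_range L M (X)).reindex Sum.inl)
      ((defin_range L M (Y)).reindex Sum.inr)) fun z => ?_
    constructor
    · rintro ⟨p, rfl⟩
      exact ⟨⟨p.1, rfl⟩, ⟨p.2, rfl⟩⟩
    · rintro ⟨⟨x, hx⟩, ⟨y, hy⟩⟩
      exact ⟨(x, y), by simp only [hx, hy, Sum.elim_comp_inl_inr]⟩

theorem enc_pair (x : X) (y : Y) : enc L M (x, y) = Sum.elim (enc L M x) (enc L M y) := rfl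

theorem dfn_comp {g : Y → Z} {f : X → Y} (hg : Dfn L M g) (hf : Dfn L M f) :
    Dfn L M fun x => g (f x) := by
  have h1 := Defin.reindex hf (β := (Idx L M X ⊕ Idx L M Z) ⊕ Idx L M Y)
    (Sum.elim (fun i => Sum.inl (Sum.inl i)) Sum.inr)
  have h2 := Defin.reindex hg (β := (Idx L M X ⊕ Idx L M Z) ⊕ Idx L M Y)
    (Sum.elim Sum.inr (fun i => Sum.inl (Sum.inr i)))
  refine Defin.congr (Defin.ex (Defin.and h1 h2)) fun z => ?_
  constructor
  · rintro ⟨x, hx, hz⟩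
    exact ⟨enc L M (f x), ⟨x, hx, rfl⟩, f x, rfl, hz⟩
  · rintro ⟨w, ⟨x, hx, hw⟩, y, hy, hz⟩
    have : f x = y := enc_injective (hw.trans hy.symm)
    subst this
    exact ⟨x, hx, hz⟩

@[fun_prop]
theorem dfn_id : Dfn L M fun x : X => x := by
  refine Defin.congr (Defin.and ((defin_range L M (X)).reindex Sum.inl)
    (Defin.comp_eq Sum.inl Sum.inr)) fun z => ?_
  constructor
  · rintro ⟨x, h1, h2⟩
    exact ⟨⟨x, h1⟩, h1.symm.trans h2⟩
  · rintro ⟨⟨x, h1⟩, h2⟩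
    exact ⟨x, h1, h1.trans h2⟩

@[fun_prop]
theorem dfn_const (c : Y) : Dfn L M fun _ : X => c := by
  refine Defin.congr (Defin.and ((defin_range L M (X)).reindex Sum.inl)
    (Defin.comp_eq_const Sum.inr (enc L M c))) fun z => ?_
  constructor
  · rintro ⟨x, h1, h2⟩
    exact ⟨⟨x, h1⟩, h2.symm⟩
  · rintro ⟨⟨x, h1⟩, h2⟩
    exact ⟨x, h1, h2.symm⟩

attribute [fun_prop] dfn_comp

@[fun_prop]
theorem dfn_prodMk {f : X → Y} {g : X → Z} (hf : Dfn L M f) (hg : Dfn L M g) :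
    Dfn L M fun x => (f x, g x) := by
  have h1 := Defin.reindex hf (β := Idx L M X ⊕ Idx L M Y ⊕ Idx L M Z)
    (Sum.elim Sum.inl (fun i => Sum.inr (Sum.inl i)))
  have h2 := Defin.reindex hg (β := Idx L M X ⊕ Idx L M Y ⊕ Idx L M Z)
    (Sum.elim Sum.inl (fun i => Sum.inr (Sum.inr i)))
  refine Defin.congr (Defin.and h1 h2) fun z => ?_
  constructor
  · rintro ⟨x, h1, h2⟩
    rw [enc_pair] at h2
    exact ⟨⟨x, h1, congrArg (· ∘ Sum.inl) h2⟩, ⟨x, h1, congrArg (· ∘ Sum.inr) h2⟩⟩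
  · rintro ⟨⟨x, h1, h2⟩, ⟨x', h3, h4⟩⟩
    have : x = x' := enc_injective (h1.trans h3.symm)
    subst this
    refine ⟨x, h1, ?_⟩
    rw [enc_pair, h2, h4]
    exact Sum.elim_comp_inl_inr (z ∘ Sum.inr)

theorem dfn_fst' : Dfn L M fun p : X × Y => p.1 := by
  refine Defin.congr (Defin.and
    ((defin_range L M (X × Y)).reindex Sum.inl)
    (Defin.comp_eq (fun i => Sum.inl (Sum.inl i)) Sum.inr)) fun z => ?_
  constructor
  · rintro ⟨x, h1, h2⟩
    exact ⟨⟨x, h1⟩, (congrArg (· ∘ Sum.inl) h1).symm.trans h2⟩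
  · rintro ⟨⟨x, h1⟩, h2⟩
    exact ⟨x, h1, (congrArg (· ∘ Sum.inl) h1).trans h2⟩

theorem dfn_snd' : Dfn L M fun p : X × Y => p.2 := by
  refine Defin.congr (Defin.and
    ((defin_range L M (X × Y)).reindex Sum.inl)
    (Defin.comp_eq (fun i => Sum.inl (Sum.inr i)) Sum.inr)) fun z => ?_
  constructor
  · rintro ⟨x, h1, h2⟩
    exact ⟨⟨x, h1⟩, (congrArg (· ∘ Sum.inr) h1).symm.trans h2⟩
  · rintro ⟨⟨x, h1⟩, h2⟩
    exact ⟨x, h1, (congrArg (· ∘ Sum.inr) h1).trans h2⟩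

@[fun_prop]
theorem dfn_fst {f : X → Y × Z} (hf : Dfn L M f) : Dfn L M fun x => (f x).1 :=
  dfn_comp dfn_fst' hf

@[fun_prop]
theorem dfn_snd {f : X → Y × Z} (hf : Dfn L M f) : Dfn L M fun x => (f x).2 :=
  dfn_comp dfn_snd' hf

end Definability

section Logic

variable {L : FirstOrder.Language} {M : Type} [L.Structure M] [LinearOrder M]
variable {X Y Z : Type} [Srt L M X] [Srt L M Y] [Srt L M Z]

theorem OMinimal.exists_ne (h : OMinimal L M) : ∃ p : M × M, p.1 ≠ p.2 := by
  obtain ⟨-, -, h, ⟨a⟩, -⟩ := h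
  obtain ⟨b, hb⟩ := exists_gt a
  exact ⟨(a, b), hb.ne⟩

open Classical in
/-- Truth values are encoded by two distinct points of `M`, so that definable predicates are
definable maps to `Prop`. -/
noncomputable instance [h : Fact (OMinimal L M)] : Srt L M Prop where
  Idx := Unit
  finite_idx := inferInstance
  tuple p _ := if p then h.out.exists_ne.choose.1 else h.out.exists_ne.choose.2
  tuple_injective p q hpq := by
    have := congrFun hpq ()
    have hne := h.out.exists_ne.choose_spec
    by_cases hp : p <;> by_cases hq : q <;> simp [hp, hq] at this ⊢
    · exact hne this
    · exact hne this.symm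
  defin_range := by
    refine Defin.congr (Set.Definable.union
      (Defin.eq_const (L := L) () h.out.exists_ne.choose.1)
      (Defin.eq_const (L := L) () h.out.exists_ne.choose.2)) fun z => ?_
    constructor
    · rintro ⟨p, rfl⟩
      by_cases hp : p
      · exact Or.inl (if_pos hp)
      · exact Or.inr (if_neg hp)
    · rintro (hz | hz)
      · exact ⟨True, funext fun _ => (if_pos trivial).trans hz.symm⟩
      · exact ⟨False, funext fun _ => (if_neg id).trans hz.symm⟩

variable [h : Fact (OMinimal L M)]

theorem dfn_iff_defin {P : X → Prop} :
    Dfn L M P ↔ Defin L M {z | ∃ x, enc L M x = z ∧ P x} := by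
  constructor
  · intro hP
    refine Defin.congr (Defin.ex (Defin.and hP
      (Defin.comp_eq_const Sum.inr (enc L M True)))) fun z => ?_
    constructor
    · rintro ⟨x, rfl, hx⟩
      refine ⟨enc L M True, ⟨x, rfl, ?_⟩, rfl⟩
      rw [eq_true hx]
      rfl
    · rintro ⟨w, ⟨x, hx, hw⟩, hw'⟩
      exact ⟨x, hx, of_eq_true (enc_injective (hw.trans hw'))⟩
  · intro hP
    have h1 := Defin.and (Defin.reindex hP Sum.inl (β := Idx L M X ⊕ Unit))
      (Defin.comp_eq_const Sum.inr (enc L M True))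
    have h2 := Defin.and (Defin.and (Set.Definable.compl (Defin.reindex hP Sum.inl
      (β := Idx L M X ⊕ Unit))) ((defin_range L M X).reindex Sum.inl))
      (Defin.comp_eq_const Sum.inr (enc L M False))
    refine Defin.congr (Set.Definable.union h1 h2) fun z => ?_
    constructor
    · rintro ⟨x, h1, h2⟩
      by_cases hx : P x
      · rw [eq_true hx] at h2
        exact Or.inl ⟨⟨x, h1, hx⟩, h2.symm⟩
      · rw [eq_false hx] at h2
        refine Or.inr ⟨⟨?_, ⟨x, h1⟩⟩, h2.symm⟩
        rintro ⟨y, hy, hPy⟩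
        exact hx (enc_injective (h1.trans hy.symm) ▸ hPy)
    · rintro (⟨⟨x, h1, h2⟩, h3⟩ | ⟨⟨h1, ⟨x, h2⟩⟩, h3⟩)
      · refine ⟨x, h1, ?_⟩
        rw [eq_true h2]
        exact h3.symm
      · refine ⟨x, h2, ?_⟩
        rw [eq_false fun hx => h1 ⟨x, h2, hx⟩]
        exact h3.symm

@[fun_prop]
theorem dfn_and {P Q : X → Prop} (hP : Dfn L M P) (hQ : Dfn L M Q) :
    Dfn L M fun x => P x ∧ Q x := by
  rw [dfn_iff_defin] at *
  refine Defin.congr (Defin.and hP hQ) fun z => ?_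
  constructor
  · rintro ⟨x, h1, h2, h3⟩
    exact ⟨⟨x, h1, h2⟩, ⟨x, h1, h3⟩⟩
  · rintro ⟨⟨x, h1, h2⟩, ⟨x', h3, h4⟩⟩
    exact ⟨x, h1, h2, enc_injective (h3.trans h1.symm) ▸ h4⟩

@[fun_prop]
theorem dfn_not {P : X → Prop} (hP : Dfn L M P) : Dfn L M fun x => ¬ P x := by
  rw [dfn_iff_defin] at *
  refine Defin.congr (Defin.and (defin_range L M X) (Set.Definable.compl hP)) fun z => ?_
  constructor
  · rintro ⟨x, h1, h2⟩
    refine ⟨⟨x, h1⟩, ?_⟩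
    rintro ⟨y, hy, hPy⟩
    exact h2 (enc_injective (h1.trans hy.symm) ▸ hPy)
  · rintro ⟨⟨x, h1⟩, h2⟩
    exact ⟨x, h1, fun hx => h2 ⟨x, h1, hx⟩⟩

@[fun_prop]
theorem dfn_or {P Q : X → Prop} (hP : Dfn L M P) (hQ : Dfn L M Q) :
    Dfn L M fun x => P x ∨ Q x := by
  have : (fun x => P x ∨ Q x) = fun x => ¬ (¬ P x ∧ ¬ Q x) := by
    funext x; rw [not_and_or, not_not, not_not]
  rw [this]
  fun_prop

@[fun_prop]
theorem dfn_imp {P Q : X → Prop} (hP : Dfn L M P) (hQ : Dfn L M Q) :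
    Dfn L M fun x => P x → Q x := by
  have : (fun x => P x → Q x) = fun x => ¬ P x ∨ Q x := by
    funext x; rw [imp_iff_not_or]
  rw [this]
  fun_prop

@[fun_prop]
theorem dfn_exists {P : X → Y → Prop} (hP : Dfn L M fun p : X × Y => P p.1 p.2) :
    Dfn L M fun x => ∃ y, P x y := by
  rw [dfn_iff_defin] at *
  refine Defin.congr (Defin.ex hP) fun z => ?_
  constructor
  · rintro ⟨x, h1, y, h2⟩
    refine ⟨enc L M y, (x, y), ?_, h2⟩
    rw [enc_pair, h1]
  · rintro ⟨w, ⟨x, y⟩, h1, h2⟩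
    exact ⟨x, congrArg (· ∘ Sum.inl) h1, y, h2⟩

@[fun_prop]
theorem dfn_forall {P : X → Y → Prop} (hP : Dfn L M fun p : X × Y => P p.1 p.2) :
    Dfn L M fun x => ∀ y, P x y := by
  have : (fun x => ∀ y, P x y) = fun x => ¬ ∃ y, ¬ P x y := by
    funext x; simp
  rw [this]
  fun_prop

@[fun_prop]
theorem dfn_eq {f g : X → Y} (hf : Dfn L M f) (hg : Dfn L M g) :
    Dfn L M fun x => f x = g x := by
  rw [dfn_iff_defin]
  refine Defin.congr (Defin.ex (Defin.and hf hg)) fun z => ?_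
  constructor
  · rintro ⟨x, h1, h2⟩
    refine ⟨enc L M (f x), ⟨x, h1, rfl⟩, ⟨x, h1, ?_⟩⟩
    rw [h2]
    rfl
  · rintro ⟨w, ⟨x, h1, h2⟩, ⟨x', h3, h4⟩⟩
    have := enc_injective (h1.trans h3.symm)
    subst this
    exact ⟨x, h1, enc_injective (h2.trans h4.symm)⟩

@[fun_prop]
theorem dfn_lt {f g : X → M} (hf : Dfn L M f) (hg : Dfn L M g) :
    Dfn L M fun x => f x < g x := by
  have hlt : Dfn L M fun p : M × M => p.1 < p.2 := by
    rw [dfn_iff_defin]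
    refine Defin.congr (Defin.reindex h.out.2.2.2.2.1 (β := Unit ⊕ Unit)
      ![Sum.inl (), Sum.inr ()]) fun z => ?_
    constructor
    · rintro ⟨x, rfl, h⟩
      exact h
    · intro h
      exact ⟨(z (Sum.inl ()), z (Sum.inr ())), by ext (i | i) <;> rfl, h⟩
  exact dfn_comp hlt (dfn_prodMk hf hg)

@[fun_prop]
theorem dfn_le {f g : X → M} (hf : Dfn L M f) (hg : Dfn L M g) :
    Dfn L M fun x => f x ≤ g x := by
  simp only [← not_lt]
  fun_prop

theorem dfn_of_graph {f : X → Y} (hf : Dfn L M fun p : X × Y => f p.1 = p.2) : Dfn L M f := by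
  rw [dfn_iff_defin] at hf
  refine Defin.congr hf fun z => ?_
  constructor
  · rintro ⟨x, h1, h2⟩
    refine ⟨(x, f x), ?_, rfl⟩
    rw [enc_pair, h1, h2]
    exact Sum.elim_comp_inl_inr z
  · rintro ⟨⟨x, y⟩, h1, h2⟩
    have h2 : f x = y := h2
    subst h2
    exact ⟨x, congrArg (· ∘ Sum.inl) h1, congrArg (· ∘ Sum.inr) h1⟩

end Logic

section OneDim

open Filter Topology Set

variable {L : FirstOrder.Language} {M : Type} [L.Structure M] [LinearOrder M]
  [h : Fact (OMinimal L M)] [DenselyOrdered M] [NoMinOrder M] [NoMaxOrder M] [Nonempty M]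

variable (L) in
theorem exists_pieces {s : M → Prop} (hs : Dfn L M s) :
    ∃ (n : ℕ) (t : Fin n → Set M), (∀ i, IsPointOrInterval M (t i)) ∧ {x | s x} = ⋃ i, t i := by
  refine h.out.2.2.2.2.2 _ ?_
  rw [dfn_iff_defin] at hs
  refine Defin.congr (Defin.reindex hs (β := Fin 1) fun _ => 0) fun z => ?_
  constructor
  · intro hz
    exact ⟨z 0, rfl, hz⟩
  · rintro ⟨x, hx, hsx⟩
    have : x = z 0 := congrFun hx ()
    exact this ▸ hsx

variable (L) in
theorem infinite_iff {s : M → Prop} (hs : Dfn L M s) :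
    {x | s x}.Infinite ↔ ∃ a b, a < b ∧ ∀ y, a < y → y < b → s y := by
  constructor
  · intro hinf
    obtain ⟨n, t, ht, hst⟩ := exists_pieces L hs
    have hi : ∃ i, (t i).Infinite := by
      by_contra! hfin
      exact hinf (hst ▸ Set.finite_iUnion hfin)
    obtain ⟨i, hi⟩ := hi
    obtain ⟨a, b, hab, hsub⟩ : ∃ a b, a < b ∧ Set.Ioo a b ⊆ t i := by
      rcases ht i with ⟨a, ha⟩ | ⟨a, b, ha⟩ | ⟨a, ha⟩ | ⟨a, ha⟩ | ha <;> rw [ha] at hi ⊢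
      · exact absurd (Set.finite_singleton a) hi
      · exact ⟨a, b, Set.nonempty_Ioo.1 hi.nonempty, subset_rfl⟩
      · obtain ⟨b, hb⟩ := exists_gt a
        exact ⟨a, b, hb, Set.Ioo_subset_Ioi_self⟩
      · obtain ⟨b, hb⟩ := exists_lt a
        exact ⟨b, a, hb, Set.Ioo_subset_Iio_self⟩
      · obtain ⟨b, hb⟩ := exists_gt (Classical.arbitrary M)
        exact ⟨_, b, hb, Set.subset_univ _⟩
    refine ⟨a, b, hab, fun y h1 h2 => ?_⟩
    have : y ∈ {x | s x} := hst ▸ Set.mem_iUnion.2 ⟨i, hsub ⟨h1, h2⟩⟩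
    exact this
  · rintro ⟨a, b, hab, hy⟩
    exact (Set.Ioo_infinite hab).mono fun y hy' => hy y hy'.1 hy'.2

theorem IsPointOrInterval.eventually_right [TopologicalSpace M] [OrderTopology M] {t : Set M}
    (ht : IsPointOrInterval M t) (x : M) :
    (∀ᶠ y in 𝓝[>] x, y ∈ t) ∨ ∀ᶠ y in 𝓝[>] x, y ∉ t := by
  rcases ht with ⟨a, rfl⟩ | ⟨a, b, rfl⟩ | ⟨a, rfl⟩ | ⟨a, rfl⟩ | rfl
  · right
    rcases lt_or_ge x a with hxa | hxa
    · filter_upwards [Ioo_mem_nhdsGT hxa] with y hy using hy.2.ne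
    · filter_upwards [self_mem_nhdsWithin] with y hy using (lt_of_le_of_lt hxa hy).ne'
  · rcases lt_or_ge x a with hxa | hxa
    · right
      filter_upwards [Ioo_mem_nhdsGT hxa] with y hy hy' using lt_asymm hy.2 hy'.1
    · rcases lt_or_ge x b with hxb | hxb
      · left
        filter_upwards [Ioo_mem_nhdsGT hxb] with y hy using ⟨lt_of_le_of_lt hxa hy.1, hy.2⟩
      · right
        filter_upwards [self_mem_nhdsWithin] with y hy hy'
        exact lt_asymm (lt_of_le_of_lt hxb hy) hy'.2
  · rcases lt_or_ge x a with hxa | hxa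
    · right
      filter_upwards [Ioo_mem_nhdsGT hxa] with y hy hy' using lt_asymm hy.2 hy'
    · left
      filter_upwards [self_mem_nhdsWithin] with y hy using lt_of_le_of_lt hxa hy
  · rcases lt_or_ge x a with hxb | hxb
    · left
      filter_upwards [Ioo_mem_nhdsGT hxb] with y hy using hy.2
    · right
      filter_upwards [self_mem_nhdsWithin] with y hy hy'
      exact lt_asymm (lt_of_le_of_lt hxb hy) hy'
  · exact Or.inl (Eventually.of_forall fun _ => trivial)

theorem eventually_or_of_pieces {n : ℕ} {t : Fin n → Set M} {s : M → Prop}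
    (hst : {x | s x} = ⋃ i, t i) {l : Filter M}
    (ht : ∀ i, (∀ᶠ y in l, y ∈ t i) ∨ ∀ᶠ y in l, y ∉ t i) :
    (∀ᶠ y in l, s y) ∨ ∀ᶠ y in l, ¬ s y := by
  have hs : ∀ y, s y ↔ ∃ i, y ∈ t i := fun y => by
    rw [← Set.mem_iUnion, ← hst]; rfl
  by_cases hi : ∃ i, ∀ᶠ y in l, y ∈ t i
  · obtain ⟨i, hi⟩ := hi
    exact Or.inl (hi.mono fun y hy => (hs y).2 ⟨i, hy⟩)
  · rw [not_exists] at hi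
    refine Or.inr ((eventually_all.2 fun i => (ht i).resolve_left (hi i)).mono fun y hy => ?_)
    rw [hs]
    push Not
    exact hy

variable (L) in
theorem eventually_right_or [TopologicalSpace M] [OrderTopology M] {s : M → Prop}
    (hs : Dfn L M s) (x : M) : (∀ᶠ y in 𝓝[>] x, s y) ∨ ∀ᶠ y in 𝓝[>] x, ¬ s y := by
  obtain ⟨n, t, ht, hst⟩ := exists_pieces L hs
  exact eventually_or_of_pieces hst fun i => (ht i).eventually_right x

theorem IsPointOrInterval.exists_isLUB {t : Set M} (ht : IsPointOrInterval M t)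
    (hne : t.Nonempty) (hb : BddAbove t) : ∃ a, IsLUB t a := by
  rcases ht with ⟨a, rfl⟩ | ⟨a, b, rfl⟩ | ⟨a, rfl⟩ | ⟨a, rfl⟩ | rfl
  · exact ⟨a, isLUB_singleton⟩
  · exact ⟨b, isLUB_Ioo (Set.nonempty_Ioo.1 hne)⟩
  · exact absurd hb (not_bddAbove_Ioi a)
  · exact ⟨a, isLUB_Iio⟩
  · exact absurd hb not_bddAbove_univ

variable (L) in
theorem exists_isLUB {s : M → Prop} (hs : Dfn L M s) (hne : ∃ x, s x)
    (hb : ∃ b, ∀ x, s x → x ≤ b) : ∃ a, IsLUB {x | s x} a := by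
  obtain ⟨n, t, ht, hst⟩ := exists_pieces L hs
  have hsub : ∀ i, t i ⊆ {x | s x} := fun i => hst ▸ Set.subset_iUnion t i
  have : ∀ i, ∃ a, (t i).Nonempty → IsLUB (t i) a := fun i => by
    by_cases hi : (t i).Nonempty
    · obtain ⟨a, ha⟩ := (ht i).exists_isLUB hi (hb.imp fun b hb x hx => hb x (hsub i hx))
      exact ⟨a, fun _ => ha⟩
    · exact ⟨Classical.arbitrary M, fun h => absurd h hi⟩
  choose a ha using this
  have hfin : {i | (t i).Nonempty}.Finite := Set.toFinite _
  obtain ⟨x, hx⟩ := hne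
  have hx' : x ∈ ⋃ i, t i := hst ▸ hx
  obtain ⟨i, hi⟩ := Set.mem_iUnion.1 hx'
  obtain ⟨j, hj, hmax⟩ := Set.exists_max_image _ a hfin ⟨i, x, hi⟩
  refine ⟨a j, ?_, fun b hb => (ha j hj).2 fun y hy => hb (hsub j hy)⟩
  intro y hy
  have hy' : y ∈ ⋃ i, t i := hst ▸ hy
  obtain ⟨i, hi⟩ := Set.mem_iUnion.1 hy'
  exact ((ha i ⟨y, hi⟩).1 hi).trans (hmax i ⟨y, hi⟩)

variable (L) in
theorem exists_isGLB {s : M → Prop} (hs : Dfn L M s) (hne : ∃ x, s x)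
    (hb : ∃ b, ∀ x, s x → b ≤ x) : ∃ a, IsGLB {x | s x} a := by
  obtain ⟨a, ha⟩ := exists_isLUB L (s := fun x => ∀ y, s y → x ≤ y) (by fun_prop)
    hb (hne.imp fun x hx y hy => hy x hx)
  exact ⟨a, isLUB_lowerBounds.1 ha⟩

/-- `x` is a boundary point of the predicate `s`. -/
def Bdry (s : M → Prop) (x : M) : Prop :=
  ¬ ∃ a b, a < x ∧ x < b ∧ ((∀ y, a < y → y < b → s y) ∨ ∀ y, a < y → y < b → ¬ s y)

variable (L) in
theorem bdry_finite {s : M → Prop} (hs : Dfn L M s) : {x | Bdry s x}.Finite := by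
  by_contra hinf
  unfold Bdry at hinf
  rw [← Set.Infinite, infinite_iff L (by fun_prop)] at hinf
  obtain ⟨a, b, hab, hbd⟩ := hinf
  have hunion : {x | (a < x ∧ x < b) ∧ s x} ∪ {x | (a < x ∧ x < b) ∧ ¬ s x} = Set.Ioo a b := by
    ext x
    by_cases s x <;> simp [*]
  have := Set.infinite_union.1 (hunion ▸ Set.Ioo_infinite hab)
  rw [infinite_iff L (by fun_prop), infinite_iff L (by fun_prop)] at this
  obtain ⟨c, d, hcd, h1⟩ | ⟨c, d, hcd, h1⟩ := this <;> obtain ⟨x, hx⟩ := exists_between hcd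
  · exact hbd x (h1 x hx.1 hx.2).1.1 (h1 x hx.1 hx.2).1.2
      ⟨c, d, hx.1, hx.2, Or.inl fun y h2 h3 => (h1 y h2 h3).2⟩
  · exact hbd x (h1 x hx.1 hx.2).1.1 (h1 x hx.1 hx.2).1.2
      ⟨c, d, hx.1, hx.2, Or.inr fun y h2 h3 => (h1 y h2 h3).2⟩

theorem bdry_not {s : M → Prop} {x : M} : Bdry (fun x => ¬ s x) x ↔ Bdry s x := by
  simp only [Bdry, not_not]
  simp only [or_comm]

variable (L) in
theorem of_not_bdry {s : M → Prop} (hs : Dfn L M s) {x y : M} (hxy : x < y) (hx : s x)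
    (hb : ∀ z, x ≤ z → z ≤ y → ¬ Bdry s z) : s y := by
  obtain ⟨c, hc⟩ := exists_isLUB L (s := fun z => (x ≤ z ∧ z ≤ y) ∧ ∀ w, x ≤ w → w ≤ z → s w)
    (by fun_prop) ⟨x, ⟨le_rfl, hxy.le⟩, fun w h1 h2 => le_antisymm h1 h2 ▸ hx⟩
    ⟨y, fun z hz => hz.1.2⟩
  have hxc : x ≤ c := hc.1 ⟨⟨le_rfl, hxy.le⟩, fun w h1 h2 => le_antisymm h1 h2 ▸ hx⟩
  have hcy : c ≤ y := hc.2 fun z hz => hz.1.2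
  obtain ⟨a, b, hac, hcb, hab⟩ := not_not.1 (hb c hxc hcy)
  obtain ⟨z, ⟨⟨hz1, hz2⟩, hz⟩, haz, hzc⟩ := hc.exists_between hac
  have hab : ∀ y, a < y → y < b → s y := by
    refine hab.resolve_right fun hn => ?_
    exact hn z haz (lt_of_le_of_lt hzc hcb) (hz z hz1 le_rfl)
  have key : ∀ w, x ≤ w → w < b → s w := fun w h1 h2 => by
    rcases le_or_gt w z with h3 | h3
    · exact hz w h1 h3
    · exact hab w (haz.trans h3) h2
  by_contra hsy
  have hby : b ≤ y := by
    by_contra hby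
    exact hsy (key y hxy.le (not_le.1 hby))
  obtain ⟨d, hcd, hdb⟩ := exists_between hcb
  exact hcd.not_ge (hc.1 ⟨⟨hxc.trans hcd.le, hdb.le.trans hby⟩,
    fun w h1 h2 => key w h1 (lt_of_le_of_lt h2 hdb)⟩)

end OneDim

section Planar

open Filter Topology Set

variable {L : FirstOrder.Language} {M : Type} [L.Structure M] [LinearOrder M]
  [h : Fact (OMinimal L M)] [DenselyOrdered M] [NoMinOrder M] [NoMaxOrder M] [Nonempty M]
variable {X Y Z : Type} [Srt L M X] [Srt L M Y] [Srt L M Z]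

theorem dfn_infinite {s : X → M → Prop} (hs : Dfn L M fun p : X × M => s p.1 p.2) :
    Dfn L M fun x => {y | s x y}.Infinite := by
  have : (fun x => {y | s x y}.Infinite) = fun x => ∃ a b, a < b ∧ ∀ y, a < y → y < b → s x y := by
    funext x
    rw [infinite_iff L (by fun_prop)]
  rw [this]
  fun_prop

theorem eventually_left_not_of_finite [TopologicalSpace M] [OrderTopology M] {s : M → Prop}
    (hs : {x | s x}.Finite) (x : M) : ∀ᶠ y in 𝓝[<] x, ¬ s y := by
  have h1 : ({y | s y} \ {x})ᶜ ∈ 𝓝 x :=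
    (hs.subset sdiff_subset).isClosed.isOpen_compl.mem_nhds (by simp)
  filter_upwards [nhdsWithin_le_nhds h1, self_mem_nhdsWithin] with y hy hyx hsy
  exact hy ⟨hsy, ne_of_lt hyx⟩

theorem eventually_right_not_of_finite [TopologicalSpace M] [OrderTopology M] {s : M → Prop}
    (hs : {x | s x}.Finite) (x : M) : ∀ᶠ y in 𝓝[>] x, ¬ s y := by
  have h1 : ({y | s y} \ {x})ᶜ ∈ 𝓝 x :=
    (hs.subset sdiff_subset).isClosed.isOpen_compl.mem_nhds (by simp)
  filter_upwards [nhdsWithin_le_nhds h1, self_mem_nhdsWithin] with y hy hyx hsy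
  exact hy ⟨hsy, ne_of_gt hyx⟩

/-- There is no definable function `f` on an interval with `f u > u` such that every point lies
in only finitely many of the intervals `(u, f u)`. -/
theorem no_thin_function [TopologicalSpace M] [OrderTopology M] {f : M → M} (hf : Dfn L M f)
    {α β : M} (hαβ : α < β) (hfu : ∀ u, α < u → u < β → u < f u)
    (hfin : ∀ c, {u | (α < u ∧ u < β) ∧ u < c ∧ c < f u}.Finite) : False := by
  have F1 : ∀ x, α < x → x ≤ β → ∀ᶠ u in 𝓝[<] x, f u ≤ x := fun x h1 h2 => by
    filter_upwards [eventually_left_not_of_finite (hfin x) x, Ioo_mem_nhdsLT h1] with u h3 h4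
    by_contra h5
    exact h3 ⟨⟨h4.1, h4.2.trans_le h2⟩, h4.2, not_le.1 h5⟩
  have F2 : ∀ x, α < x → x < β → ∀ᶠ y in 𝓝[>] x, f y < f x := fun x h1 h2 => by
    refine (eventually_right_or L (s := fun y => f y < f x) (by fun_prop) x).resolve_right ?_
    intro hev
    obtain ⟨c, hc1, hc2⟩ := exists_between (hfu x h1 h2)
    obtain ⟨y, hy1, hy2, hy3, hy4⟩ := (hev.and ((eventually_right_not_of_finite (hfin c) x).and
      ((eventually_iff.2 (Ioo_mem_nhdsGT h2)).and
        (eventually_iff.2 (Ioo_mem_nhdsGT hc1))))).exists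
    exact hy2 ⟨⟨h1.trans hy3.1, hy3.2⟩, hy4.2, hc2.trans_le (not_lt.1 hy1)⟩
  obtain ⟨a, ha1, ha2⟩ := exists_between hαβ
  rcases eventually_right_or L (s := fun x => ∀ y, a < y → y < x → f y < f x) (by fun_prop) a
    with hev | hev
  · obtain ⟨b, hb, hsub⟩ := (mem_nhdsGT_iff_exists_Ioo_subset' ha2).1 hev
    obtain ⟨x, hx1, hx2⟩ := exists_between (lt_min hb ha2)
    obtain ⟨y, hy1, hy2⟩ := ((F2 x (ha1.trans hx1) (hx2.trans_le (min_le_right _ _))).and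
      (eventually_iff.2 (Ioo_mem_nhdsGT hx2))).exists
    exact lt_asymm hy1
      (hsub ⟨hx1.trans hy2.1, hy2.2.trans_le (min_le_left _ _)⟩ x hx1 hy2.1)
  · obtain ⟨b, hb, hsub⟩ := (mem_nhdsGT_iff_exists_Ioo_subset' ha2).1 hev
    obtain ⟨c, hac, hcb⟩ := exists_between (lt_min hb ha2)
    have hcβ := hcb.trans_le (min_le_right _ _)
    have hcb' := hcb.trans_le (min_le_left _ _)
    rcases eventually_right_or L (s := fun y => f y < f c) (by fun_prop) a with hev' | hev'
    · obtain ⟨b', hb', hsub'⟩ := (mem_nhdsGT_iff_exists_Ioo_subset' hac).1 hev'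
      obtain ⟨d, hd⟩ := exists_isGLB L (s := fun y => (a < y ∧ y ≤ c) ∧ f c ≤ f y) (by fun_prop)
        ⟨c, ⟨hac, le_rfl⟩, le_rfl⟩ ⟨a, fun x hx => hx.1.1.le⟩
      have hdc : d ≤ c := hd.1 ⟨⟨hac, le_rfl⟩, le_rfl⟩
      have had : a < d := lt_of_lt_of_le hb' (hd.2 fun y hy => by
        by_contra hyb
        exact hy.2.not_gt (hsub' ⟨hy.1.1, not_le.1 hyb⟩))
      have hlt : ∀ y, a < y → y < d → f y < f c := fun y h1 h2 => by
        by_contra h3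
        exact h2.not_ge (hd.1 ⟨⟨h1, h2.le.trans hdc⟩, not_lt.1 h3⟩)
      rcases le_or_gt (f c) (f d) with h1 | h1
      · exact hsub ⟨had, hdc.trans_lt hcb'⟩ fun y h2 h3 => (hlt y h2 h3).trans_le h1
      · have hdβ := hdc.trans_lt hcβ
        obtain ⟨e, he, hsube⟩ := (mem_nhdsGT_iff_exists_Ioo_subset' hdβ).1
          (F2 d (ha1.trans had) hdβ)
        obtain ⟨y, hy, hdy, hye⟩ := hd.exists_between he
        rcases hdy.eq_or_lt with rfl | hdy
        · exact hy.2.not_gt h1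
        · exact hy.2.not_gt ((show f y < f d from hsube ⟨hdy, hye⟩).trans h1)
    · obtain ⟨b', hb', hsub'⟩ := (mem_nhdsGT_iff_exists_Ioo_subset' hac).1 hev'
      obtain ⟨x, hx1, hx2⟩ := exists_between (lt_min hb' hac)
      have hxc := hx2.trans_le (min_le_right _ _)
      obtain ⟨u, hu1, hu2⟩ := ((F1 x (ha1.trans hx1) (hxc.trans hcβ).le).and
        (eventually_iff.2 (Ioo_mem_nhdsLT hx1))).exists
      have h3 : ¬ f u < f c := hsub' ⟨hu2.1, hu2.2.trans (hx2.trans_le (min_le_left _ _))⟩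
      exact h3 (hu1.trans_lt (hxc.trans (hfu c (ha1.trans hac) hcβ)))

theorem exists_infinite_of_fan {Q : M → M → Prop} (hQ : Dfn L M fun p : M × M => Q p.1 p.2)
    {α β : M} (hαβ : α < β) (h1 : ∀ u, α < u → u < β → ∃ c, u < c ∧ Q u c)
    (h2 : ∀ u c c', Q u c → u < c' → c' < c → Q u c') :
    ∃ c, {u | u < c ∧ Q u c}.Infinite := by
  let _ := Preorder.topology M
  have : OrderTopology M := ⟨rfl⟩
  by_contra! hfin
  have hlub : ∀ u, ∃ v, (α < u ∧ u < β → IsLUB {c | (u < c ∧ c ≤ β) ∧ Q u c} v) ∧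
      (¬ (α < u ∧ u < β) → v = α) := fun u => by
    by_cases hu : α < u ∧ u < β
    · obtain ⟨c, hc, hQc⟩ := h1 u hu.1 hu.2
      obtain ⟨d, hd1, hd2⟩ := exists_between (lt_min hc hu.2)
      obtain ⟨v, hv⟩ := exists_isLUB L (s := fun c => (u < c ∧ c ≤ β) ∧ Q u c) (by fun_prop)
        ⟨d, ⟨hd1, (hd2.trans_le (min_le_right _ _)).le⟩,
          h2 u c d hQc hd1 (hd2.trans_le (min_le_left _ _))⟩ ⟨β, fun x hx => hx.1.2⟩
      exact ⟨v, fun _ => hv, fun h => absurd hu h⟩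
    · exact ⟨α, fun h => absurd h hu, fun _ => rfl⟩
  choose f hf1 hf2 using hlub
  have hlt : ∀ u, α < u → u < β → ∀ c, u < c → c < f u → Q u c := fun u h3 h4 c h5 h6 => by
    obtain ⟨d, hd, hcd, -⟩ := (hf1 u ⟨h3, h4⟩).exists_between h6
    exact h2 u d c hd.2 h5 hcd
  refine no_thin_function (L := L) (f := f) ?_ hαβ (fun u hu1 hu2 => ?_) fun c =>
    (hfin c).subset fun u hu => ⟨hu.2.1, hlt u hu.1.1 hu.1.2 c hu.2.1 hu.2.2⟩
  · refine dfn_of_graph ?_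
    have : (fun p : M × M => f p.1 = p.2) = fun p : M × M =>
        ((α < p.1 ∧ p.1 < β) ∧ (∀ c, (p.1 < c ∧ c ≤ β) ∧ Q p.1 c → c ≤ p.2) ∧
          ∀ d, (∀ c, (p.1 < c ∧ c ≤ β) ∧ Q p.1 c → c ≤ d) → p.2 ≤ d) ∨
        (¬ (α < p.1 ∧ p.1 < β) ∧ p.2 = α) := by
      funext p
      refine propext ⟨?_, ?_⟩
      · intro hp
        by_cases hu : α < p.1 ∧ p.1 < β
        · exact Or.inl ⟨hu, fun c hc => hp ▸ (hf1 _ hu).1 hc, fun d hd => hp ▸ (hf1 _ hu).2 hd⟩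
        · exact Or.inr ⟨hu, hp ▸ hf2 _ hu⟩
      · rintro (⟨hu, h3, h4⟩ | ⟨hu, h3⟩)
        · exact (hf1 _ hu).unique ⟨h3, h4⟩
        · rw [hf2 _ hu, h3]
    rw [this]
    fun_prop
  · obtain ⟨c, hc, hQc⟩ := h1 u hu1 hu2
    obtain ⟨d, hd1, hd2⟩ := exists_between (lt_min hc hu2)
    exact hd1.trans_le ((hf1 u ⟨hu1, hu2⟩).1 ⟨⟨hd1, (hd2.trans_le (min_le_right _ _)).le⟩,
      h2 u c d hQc hd1 (hd2.trans_le (min_le_left _ _))⟩)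

theorem exists_infinite_of_antitone {ι : Type} {A : M → Prop} (hA : Dfn L M A)
    (hup : ∀ d d', A d → d < d' → A d') (hmin : ∀ d, A d → ∃ d', A d' ∧ d' < d)
    {S : Y → Prop} (hS : Dfn L M S) {N : Y → M → Prop}
    (hN : Dfn L M fun p : Y × M => N p.1 p.2) (q : Y → ι)
    (hq : ∀ y y', q y = q y' → N y = N y') (hanti : ∀ y d d', N y d → A d' → d' < d → N y d')
    (hinf : (q '' {y | S y}).Infinite) (hex : ∀ y, S y → ∃ d, A d ∧ N y d) :
    ∃ d, A d ∧ (q '' {y | S y ∧ N y d}).Infinite := by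
  obtain ⟨_, y0, hy0, -⟩ := hinf.nonempty
  obtain ⟨d0, hd0, -⟩ := hex y0 hy0
  have hlub : ∀ N' : M → Prop, ∃ v, ∀ y, S y → N y = N' →
      IsLUB {d | (A d ∧ d ≤ d0) ∧ N' d} v := fun N' => by
    by_cases h1 : ∃ y, S y ∧ N y = N'
    · obtain ⟨y, hy, rfl⟩ := h1
      obtain ⟨d, hd, hNd⟩ := hex y hy
      have hne : ∃ d, (A d ∧ d ≤ d0) ∧ N y d := by
        rcases lt_or_ge d0 d with h2 | h2
        · exact ⟨d0, ⟨hd0, le_rfl⟩, hanti y d d0 hNd hd0 h2⟩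
        · exact ⟨d, ⟨hd, h2⟩, hNd⟩
      obtain ⟨v, hv⟩ := exists_isLUB L (s := fun d => (A d ∧ d ≤ d0) ∧ N y d) (by fun_prop)
        hne ⟨d0, fun x hx => hx.1.2⟩
      exact ⟨v, fun _ _ _ => hv⟩
    · exact ⟨d0, fun y hy hNy => absurd ⟨y, hy, hNy⟩ h1⟩
  choose r' hr' using hlub
  set r : Y → M := fun y => r' (N y) with hrdef
  have hr : ∀ y, S y → IsLUB {d | (A d ∧ d ≤ d0) ∧ N y d} (r y) := fun y hy => hr' _ y hy rfl
  have hrq : ∀ y y', q y = q y' → r y = r y' := fun y y' hyy => by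
    rw [hrdef]; simp only [hq y y' hyy]
  have hlt : ∀ y, S y → ∀ d, A d → d < r y → N y d := fun y hy d hd hdr => by
    obtain ⟨c, hc, hdc, -⟩ := (hr y hy).exists_between hdr
    exact hanti y c d hc.2 hd hdc
  have hrA : ∀ y, S y → A (r y) := fun y hy => by
    obtain ⟨d, hd⟩ := (hr y hy).nonempty
    rcases ((hr y hy).1 hd).eq_or_lt with h1 | h1
    · exact h1 ▸ hd.1.1
    · exact hup _ _ hd.1.1 h1
  by_cases hfin : (r '' {y | S y}).Finite
  · have hfib : ∃ v ∈ r '' {y | S y}, (q '' {y | S y ∧ r y = v}).Infinite := by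
      by_contra! hcon
      refine hinf ((hfin.biUnion hcon).subset ?_)
      rintro _ ⟨y, hy, rfl⟩
      exact Set.mem_biUnion (Set.mem_image_of_mem r hy) ⟨y, ⟨hy, rfl⟩, rfl⟩
    obtain ⟨_, ⟨y, hy, rfl⟩, hfib⟩ := hfib
    obtain ⟨d, hd, hdr⟩ := hmin _ (hrA y hy)
    refine ⟨d, hd, hfib.mono (Set.image_mono fun y' hy' => ⟨hy'.1, ?_⟩)⟩
    exact hlt y' hy'.1 d hd (hy'.2.symm ▸ hdr)
  · have himg : r '' {y | S y} = {v | ∃ y, S y ∧ (∀ d, (A d ∧ d ≤ d0) ∧ N y d → d ≤ v) ∧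
        ∀ e, (∀ d, (A d ∧ d ≤ d0) ∧ N y d → d ≤ e) → v ≤ e} := by
      ext v
      constructor
      · rintro ⟨y, hy, rfl⟩
        exact ⟨y, hy, fun d hd => (hr y hy).1 hd, fun e he => (hr y hy).2 he⟩
      · rintro ⟨y, hy, h1, h2⟩
        exact ⟨y, hy, (hr y hy).unique ⟨h1, h2⟩⟩
    rw [himg] at hfin
    obtain ⟨u, v, huv, hsub⟩ := (infinite_iff L (by fun_prop)).1 hfin
    have hsub : ∀ w, u < w → w < v → ∃ y, S y ∧ r y = w := fun w h1 h2 => by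
      have : w ∈ r '' {y | S y} := himg ▸ hsub w h1 h2
      exact this
    obtain ⟨w, huw, hwv⟩ := exists_between huv
    have hAw : A w := by
      obtain ⟨y, hy, rfl⟩ := hsub w huw hwv
      exact hrA y hy
    refine ⟨w, hAw, fun hfin' => Set.Ioo_infinite hwv ?_⟩
    have hfac : ∀ y, r y = (Function.extend q r fun _ => w) (q y) := fun y => by
      have : Function.FactorsThrough r q := fun a b hab => hrq a b hab
      rw [this.extend_apply]
    refine (hfin'.image (Function.extend q r fun _ => w)).subset fun x hx => ?_
    obtain ⟨y, hy, rfl⟩ := hsub x (huw.trans hx.1) hx.2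
    exact ⟨q y, ⟨y, ⟨hy, hlt y hy w hAw hx.1⟩, rfl⟩, (hfac y).symm⟩

/-- `u` is the left end point of a maximal interval contained in `p`. -/
def LeftEnd (p : M → Prop) (u : M) : Prop :=
  (∃ c, u < c ∧ ∀ t, u < t → t < c → p t) ∧
    ¬ ∃ w c, w < u ∧ u < c ∧ ∀ t, w < t → t < c → p t

theorem LeftEnd.bdry {p : M → Prop} {u : M} (hu : LeftEnd p u) : Bdry p u := by
  rintro ⟨a, b, hau, hub, h1 | h1⟩
  · exact hu.2 ⟨a, b, hau, hub, h1⟩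
  · obtain ⟨c, huc, hc⟩ := hu.1
    obtain ⟨t, h2, h3⟩ := exists_between (lt_min huc hub)
    exact h1 t (hau.trans h2) (h3.trans_le (min_le_right _ _))
      (hc t h2 (h3.trans_le (min_le_left _ _)))

variable (L) in
theorem exists_leftEnd {p : M → Prop} (hp : Dfn L M p) (hinf : {t | p t}.Infinite) {d : M}
    (hd : ∀ t, p t → d < t) : ∃ u, LeftEnd p u := by
  obtain ⟨a, b, hab, hsub⟩ := (infinite_iff L hp).1 hinf
  obtain ⟨e, hae, heb⟩ := exists_between hab
  obtain ⟨u, hu⟩ := exists_isGLB L (s := fun w => w < e ∧ ∀ t, w < t → t ≤ e → p t)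
    (by fun_prop) ⟨a, hae, fun t h1 h2 => hsub t h1 (h2.trans_lt heb)⟩
    ⟨d, fun w hw => by
      by_contra hwd
      exact lt_irrefl d (hd d (hw.2 d (not_le.1 hwd) (hd e (hsub e hae heb)).le))⟩
  have hua : u ≤ a := hu.1 ⟨hae, fun t h1 h2 => hsub t h1 (h2.trans_lt heb)⟩
  have hmain : ∀ t, u < t → t ≤ e → p t := fun t h1 h2 => by
    obtain ⟨w, hw, -, hwt⟩ := hu.exists_between h1
    exact hw.2 t hwt h2
  refine ⟨u, ⟨e, hua.trans_lt hae, fun t h1 h2 => hmain t h1 h2.le⟩, ?_⟩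
  rintro ⟨w, c, hwu, huc, hwc⟩
  refine hwu.not_ge (hu.1 ⟨hwu.trans (hua.trans_lt hae), fun t h1 h2 => ?_⟩)
  rcases lt_or_ge t c with h3 | h3
  · exact hwc t h1 h3
  · exact hmain t (huc.trans_le h3) h2

@[fun_prop]
theorem dfn_leftEnd {p : X → M → Prop} (hp : Dfn L M fun z : X × M => p z.1 z.2) {f : X → M}
    (hf : Dfn L M f) : Dfn L M fun x => LeftEnd (p x) (f x) := by
  unfold LeftEnd
  fun_prop

theorem exists_infinite_image_aux {ι : Type} (q : Y → ι) {S : Y → Prop} (hS : Dfn L M S)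
    {p : Y → M → Prop} (hp : Dfn L M fun z : Y × M => p z.1 z.2)
    (hq : ∀ y y', q y = q y' → p y = p y') (hSinf : (q '' {y | S y}).Infinite)
    (hinf : ∀ y, S y → {t | p y t}.Infinite) {d : M} (hd : ∀ y t, p y t → d < t) :
    ∃ t, (q '' {y | S y ∧ p y t}).Infinite := by
  by_cases ha : ∃ u, (q '' {y | S y ∧ LeftEnd (p y) u}).Infinite
  · obtain ⟨u, hu⟩ := ha
    obtain ⟨c, huc, hc⟩ := exists_infinite_of_antitone (L := L) (A := fun c => u < c)
      (by fun_prop) (fun _ _ h1 h2 => h1.trans h2)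
      (fun c hc => (exists_between hc).imp fun _ h => ⟨h.1, h.2⟩)
      (S := fun y => S y ∧ LeftEnd (p y) u) (by fun_prop)
      (N := fun y c => ∀ t, u < t → t < c → p y t) (by fun_prop) q
      (fun y y' hyy => by simp only [hq y y' hyy])
      (fun y d d' h1 _ h2 t ht1 ht2 => h1 t ht1 (ht2.trans h2)) hu
      (fun y hy => hy.2.1)
    obtain ⟨t, ht1, ht2⟩ := exists_between huc
    exact ⟨t, hc.mono (Set.image_mono fun y hy => ⟨hy.1.1, hy.2 t ht1 ht2⟩)⟩
  · simp only [not_exists, Set.not_infinite] at ha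
    have hU : {u | ∃ y, S y ∧ LeftEnd (p y) u}.Infinite := by
      intro hfin
      refine hSinf ((hfin.biUnion fun u _ => ha u).subset ?_)
      rintro _ ⟨y, hy, rfl⟩
      obtain ⟨u, hu⟩ := exists_leftEnd L (p := p y) (by fun_prop) (hinf y hy) (hd y)
      exact Set.mem_biUnion (show u ∈ {u | ∃ y, S y ∧ LeftEnd (p y) u} from ⟨y, hy, hu⟩)
        ⟨y, ⟨hy, hu⟩, rfl⟩
    obtain ⟨α, β, hαβ, hsub⟩ := (infinite_iff L (by fun_prop)).1 hU
    obtain ⟨c, hc⟩ := exists_infinite_of_fan (L := L)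
      (Q := fun u c => ∃ y, S y ∧ LeftEnd (p y) u ∧ ∀ t, u < t → t ≤ c → p y t) (by fun_prop)
      hαβ (fun u h1 h2 => by
        obtain ⟨y, hy, hu⟩ := hsub u h1 h2
        obtain ⟨c, huc, hc⟩ := hu.1
        obtain ⟨c', h3, h4⟩ := exists_between huc
        exact ⟨c', h3, y, hy, hu, fun t ht1 ht2 => hc t ht1 (ht2.trans_lt h4)⟩)
      (fun u c c' ⟨y, hy, hu, hc⟩ _ h2 =>
        ⟨y, hy, hu, fun t ht1 ht2 => hc t ht1 (ht2.trans h2.le)⟩)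
    refine ⟨c, fun hfin => hc ((hfin.biUnion (t := fun i =>
      {u | ∃ y, q y = i ∧ LeftEnd (p y) u}) ?_).subset ?_)⟩
    · rintro _ ⟨y, -, rfl⟩
      refine (bdry_finite L (s := p y) (by fun_prop)).subset ?_
      rintro u ⟨y', hy', hu⟩
      exact hq y' y hy' ▸ hu.bdry
    · rintro u ⟨huc, y, hy, hu, hc⟩
      exact Set.mem_biUnion (Set.mem_image_of_mem q ⟨hy, hc c huc le_rfl⟩) ⟨y, rfl, hu⟩

theorem exists_infinite_image {ι : Type} (q : Y → ι) {S : Y → Prop} (hS : Dfn L M S)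
    {p : Y → M → Prop} (hp : Dfn L M fun z : Y × M => p z.1 z.2)
    (hq : ∀ y y', q y = q y' → p y = p y') (hSinf : (q '' {y | S y}).Infinite)
    (hinf : ∀ y, S y → {t | p y t}.Infinite) : ∃ t, (q '' {y | S y ∧ p y t}).Infinite := by
  have hp0 : Dfn L M fun z : (Y × M) × M => z.1.2 < z.2 ∧ p z.1.1 z.2 := by fun_prop
  obtain ⟨d, -, hd⟩ := exists_infinite_of_antitone (A := fun _ => True) (by fun_prop)
    (fun _ _ _ _ => trivial) (fun d _ => (exists_lt d).imp fun _ h => ⟨trivial, h⟩) hS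
    (N := fun y d => {t | d < t ∧ p y t}.Infinite)
    (dfn_infinite (s := fun (z : Y × M) t => z.2 < t ∧ p z.1 t) hp0) q
    (fun y y' hyy => by simp only [hq y y' hyy])
    (fun y d d' h1 _ h2 => h1.mono fun t ht => ⟨h2.trans ht.1, ht.2⟩) hSinf
    (fun y hy => by
      obtain ⟨a, b, hab, hsub⟩ := (infinite_iff L (by fun_prop)).1 (hinf y hy)
      exact ⟨a, trivial, (Set.Ioo_infinite hab).mono fun t ht => ⟨ht.1, hsub t ht.1 ht.2⟩⟩)
  have hp1 : Dfn L M fun z : Y × M => d < z.2 ∧ p z.1 z.2 := by fun_prop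
  have hS1 : Dfn L M fun y => S y ∧ {t | d < t ∧ p y t}.Infinite :=
    dfn_and hS (dfn_infinite (s := fun y t => d < t ∧ p y t) hp1)
  have hq1 : ∀ y y', q y = q y' →
      (fun t => d < t ∧ p y t) = fun t => d < t ∧ p y' t := fun y y' hyy => by rw [hq y y' hyy]
  obtain ⟨t, ht⟩ := exists_infinite_image_aux q hS1 (p := fun y t => d < t ∧ p y t) hp1 hq1 hd
    (fun y hy => hy.2) (fun y t ht => ht.1)
  exact ⟨t, ht.mono (Set.image_mono fun y hy => ⟨hy.1.1, hy.2.2⟩)⟩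

end Planar

section Coordinates

variable (L : FirstOrder.Language) (M : Type) [L.Structure M] {X : Type} [Srt L M X]

/-- The coordinate functions of a sort. -/
def crd (i : Idx L M X) (x : X) : M := enc L M x i

/-- `RankGE L M s n` says that the o-minimal dimension of `s` is at least `n`: after fixing one
coordinate in infinitely many ways, the dimension is still at least `n - 1`. -/
def RankGE (s : X → Prop) : ℕ → Prop
  | 0 => ∃ x, s x
  | n + 1 => ∃ i : Idx L M X, {t | RankGE (fun x => s x ∧ crd L M i x = t) n}.Infinite

variable {L M}

theorem rankGE_zero {s : X → Prop} : RankGE L M s 0 ↔ ∃ x, s x := by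
  unfold RankGE; rfl

theorem rankGE_succ {s : X → Prop} {n : ℕ} : RankGE L M s (n + 1) ↔
    ∃ i : Idx L M X, {t | RankGE L M (fun x => s x ∧ crd L M i x = t) n}.Infinite := by
  conv_lhs => unfold RankGE

theorem RankGE.mono {s s' : X → Prop} {n : ℕ} (hs : RankGE L M s n) (hss : ∀ x, s x → s' x) :
    RankGE L M s' n := by
  induction n generalizing s s' with
  | zero =>
    rw [rankGE_zero] at *
    exact hs.imp hss
  | succ n ih =>
    rw [rankGE_succ] at *
    obtain ⟨i, hi⟩ := hs
    exact ⟨i, hi.mono fun t ht => ih ht fun x hx => ⟨hss x hx.1, hx.2⟩⟩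

theorem RankGE.of_succ {s : X → Prop} {n : ℕ} (hs : RankGE L M s (n + 1)) : RankGE L M s n := by
  induction n generalizing s with
  | zero =>
    rw [rankGE_succ] at hs
    obtain ⟨i, hi⟩ := hs
    obtain ⟨t, ht⟩ := hi.nonempty
    obtain ⟨x, hx⟩ := (rankGE_zero (L := L) (M := M)).1 ht
    exact rankGE_zero.2 ⟨x, hx.1⟩
  | succ n ih =>
    rw [rankGE_succ] at *
    obtain ⟨i, hi⟩ := hs
    exact ⟨i, hi.mono fun t ht => ih ht⟩

theorem RankGE.nonempty {s : X → Prop} {n : ℕ} (hs : RankGE L M s n) : ∃ x, s x := by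
  induction n with
  | zero => exact rankGE_zero.1 hs
  | succ n ih => exact ih hs.of_succ

theorem rankGE_or {s s' : X → Prop} {n : ℕ} (hs : RankGE L M (fun x => s x ∨ s' x) n) :
    RankGE L M s n ∨ RankGE L M s' n := by
  induction n generalizing s s' with
  | zero =>
    simp only [rankGE_zero] at *
    exact exists_or.1 hs
  | succ n ih =>
    simp only [rankGE_succ] at *
    obtain ⟨i, hi⟩ := hs
    rw [← exists_or]
    refine ⟨i, ?_⟩
    rw [← Set.infinite_union]
    exact hi.mono fun t ht => ih (ht.mono fun x hx => by tauto)

theorem exists_rankGE_of_finite {ι : Type} {F : Set ι} (hF : F.Finite) {s : ι → X → Prop} {n : ℕ}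
    (hs : RankGE L M (fun x => ∃ c ∈ F, s c x) n) : ∃ c ∈ F, RankGE L M (s c) n := by
  induction F, hF using Set.Finite.induction_on with
  | empty =>
    obtain ⟨x, c, hc, -⟩ := hs.nonempty
    exact absurd hc (Set.notMem_empty c)
  | @insert a F _ _ ih =>
    rcases rankGE_or (s := s a) (s' := fun x => ∃ c ∈ F, s c x) (hs.mono fun x hx => by
      obtain ⟨c, rfl | hc, hx⟩ := hx
      · exact Or.inl hx
      · exact Or.inr ⟨c, hc, hx⟩) with h | h
    · exact ⟨a, Set.mem_insert _ _, h⟩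
    · obtain ⟨c, hc, hx⟩ := ih h
      exact ⟨c, Set.mem_insert_of_mem _ hc, hx⟩

theorem rankGE_one {s : X → Prop} : RankGE L M s 1 ↔ {x | s x}.Infinite := by
  rw [rankGE_succ]
  simp only [rankGE_zero]
  constructor
  · rintro ⟨i, hi⟩ hfin
    refine hi ((hfin.image (crd L M i)).subset ?_)
    rintro t ⟨x, hx, rfl⟩
    exact ⟨x, hx, rfl⟩
  · intro hinf
    by_contra! hfin
    refine hinf (Set.Finite.of_finite_image ((Set.Finite.pi' hfin).subset ?_)
      (Srt.tuple_injective.injOn))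
    rintro _ ⟨x, hx, rfl⟩ i
    exact ⟨x, hx, rfl⟩

/-- The dimension is at most the number of coordinates. -/
theorem RankGE.le {s : X → Prop} {n : ℕ} (hs : RankGE L M s n) : n ≤ Nat.card (Idx L M X) := by
  suffices H : n ≤ Set.ncard {i : Idx L M X | ∃ x y, s x ∧ s y ∧ crd L M i x ≠ crd L M i y} from
    H.trans (Set.ncard_le_card _)
  induction n generalizing s with
  | zero => exact Nat.zero_le _
  | succ n ih =>
    obtain ⟨i, hi⟩ := rankGE_succ.1 hs
    obtain ⟨t, ht⟩ := hi.nonempty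
    refine (Nat.succ_le_succ (ih ht)).trans (Nat.succ_le_of_lt (Set.ncard_lt_ncard
      (LE.le.ssubset_of_not_superset ?_ fun hsub => ?_) (Set.toFinite _)))
    · rintro j ⟨x, y, hx, hy, hxy⟩
      exact ⟨x, y, hx.1, hy.1, hxy⟩
    · obtain ⟨t', ht', hne⟩ := (hi.sdiff (Set.finite_singleton t)).nonempty
      obtain ⟨x, hx⟩ := RankGE.nonempty ht
      obtain ⟨y, hy⟩ := RankGE.nonempty ht'
      obtain ⟨x', y', hx', hy', hxy⟩ := hsub (show i ∈ _ from
        ⟨x, y, hx.1, hy.1, fun h => hne (hy.2.symm.trans (h.symm.trans hx.2))⟩)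
      exact hxy (hx'.2.trans hy'.2.symm)

theorem exists_rankGE_not_succ {s : X → Prop} (hs : ∃ x, s x) :
    ∃ n, RankGE L M s n ∧ ¬ RankGE L M s (n + 1) := by
  by_contra! hcon
  have : ∀ n, RankGE L M s n := fun n => by
    induction n with
    | zero => exact rankGE_zero.2 hs
    | succ n ih => exact hcon n ih
  exact absurd (this _).le (Nat.not_succ_le_self _)

theorem dfn_crd' (i : Idx L M X) : Dfn L M fun x : X => crd L M i x := by
  refine Defin.congr (Defin.and (Defin.comp_eq (fun _ : Unit => Sum.inl i) Sum.inr)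
    ((defin_range L M X).reindex Sum.inl)) fun z => ?_
  constructor
  · rintro ⟨x, h1, h2⟩
    exact ⟨(funext fun _ => (congrFun h1 i).symm).trans h2, x, h1⟩
  · rintro ⟨h1, x, h2⟩
    exact ⟨x, h2, (funext fun _ => congrFun h2 i).trans h1⟩

@[fun_prop]
theorem dfn_crd {Y : Type} [Srt L M Y] (i : Idx L M X) {f : Y → X} (hf : Dfn L M f) :
    Dfn L M fun y => crd L M i (f y) :=
  dfn_comp (dfn_crd' i) hf

end Coordinates

section Dimension

variable {L : FirstOrder.Language} {M : Type} [L.Structure M] [LinearOrder M]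
  [h : Fact (OMinimal L M)] [DenselyOrdered M] [NoMinOrder M] [NoMaxOrder M] [Nonempty M]
variable {X Y Z : Type} [Srt L M X] [Srt L M Y] [Srt L M Z]

theorem dfn_exists_finite {ι : Type} [Finite ι] {P : X → ι → Prop}
    (hP : ∀ i, Dfn L M fun x => P x i) : Dfn L M fun x => ∃ i, P x i := by
  rw [dfn_iff_defin]
  refine Defin.congr (Set.definable_iUnion_of_finite fun i => dfn_iff_defin.1 (hP i)) fun z => ?_
  constructor
  · rintro ⟨x, hx, i, hi⟩
    exact Set.mem_iUnion.2 ⟨i, x, hx, hi⟩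
  · intro hz
    obtain ⟨i, x, hx, hi⟩ := Set.mem_iUnion.1 hz
    exact ⟨x, hx, i, hi⟩

@[fun_prop]
theorem dfn_rankGE {s : Y → X → Prop} {n : ℕ} (hs : Dfn L M fun p : Y × X => s p.1 p.2) :
    Dfn L M fun y => RankGE L M (s y) n := by
  induction n generalizing Y with
  | zero =>
    simp only [rankGE_zero]
    fun_prop
  | succ n ih =>
    simp only [rankGE_succ]
    refine dfn_exists_finite fun i => dfn_infinite (s := fun y t =>
      RankGE L M (fun x => s y x ∧ crd L M i x = t) n) ?_
    exact ih (s := fun (p : Y × M) x => s p.1 x ∧ crd L M i x = p.2) (by fun_prop)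

/-- A definable subset of the plane has infinitely many infinite columns only if it has infinitely
many infinite rows. -/
theorem infinite_infinite_swap {p : M → M → Prop} (hp : Dfn L M fun z : M × M => p z.1 z.2)
    (hinf : {t | {u | p t u}.Infinite}.Infinite) : {u | {t | p t u}.Infinite}.Infinite := by
  intro hfin
  have hfr : Dfn L M fun u => {t | p t u}.Infinite := by
    exact dfn_infinite (s := fun u t => p t u) (by fun_prop)
  obtain ⟨u, hu⟩ := exists_infinite_image (L := L) (Y := M) id
    (S := fun t => {u | p t u}.Infinite) (dfn_infinite (s := p) hp)
    (p := fun t u => p t u ∧ ¬ {t | p t u}.Infinite)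
    (dfn_and hp (dfn_not
      (dfn_comp (f := fun z : M × M => z.2) (g := fun u => {t | p t u}.Infinite)
        hfr (by fun_prop))))
    (fun y y' hy => by rw [show y = y' from hy]) (by rwa [Set.image_id])
    (fun t ht => (Set.Infinite.sdiff ht hfin).mono fun u hu => ⟨hu.1, hu.2⟩)
  rw [Set.image_id] at hu
  obtain ⟨t, ht⟩ := hu.nonempty
  exact ht.2.2 (hu.mono fun t ht => ht.2.1)

/-- The union of infinitely many sets of dimension at least `n`, any point lying in only finitely
many of them, has dimension at least `n + 1`. -/
theorem rankGE_succ_of_finite {W : M → X → Prop} (hW : Dfn L M fun p : M × X => W p.1 p.2)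
    {n : ℕ} (hinf : {t | RankGE L M (W t) n}.Infinite) (hfin : ∀ x, {t | W t x}.Finite) :
    RankGE L M (fun x => ∃ t, W t x) (n + 1) := by
  induction n generalizing W with
  | zero =>
    rw [rankGE_one]
    intro hcon
    refine hinf ((hcon.biUnion fun x _ => hfin x).subset fun t ht => ?_)
    obtain ⟨x, hx⟩ := (rankGE_zero (L := L) (M := M)).1 ht
    exact Set.mem_biUnion (show x ∈ {x | ∃ t, W t x} from ⟨t, hx⟩) hx
  | succ n ih =>
    simp only [rankGE_succ (n := n)] at hinf
    have : ∃ i, {t | {u | RankGE L M (fun x => W t x ∧ crd L M i x = u) n}.Infinite}.Infinite := by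
      by_contra! hcon
      refine hinf ((Set.finite_iUnion hcon).subset ?_)
      rintro t ⟨i, hi⟩
      exact Set.mem_iUnion.2 ⟨i, hi⟩
    obtain ⟨i, hi⟩ := this
    refine rankGE_succ.2 ⟨i, (infinite_infinite_swap (L := L) (by fun_prop) hi).mono
      fun u hu => ?_⟩
    refine (ih (W := fun t x => W t x ∧ crd L M i x = u) (by fun_prop) hu fun x =>
      (hfin x).subset fun t ht => ht.1).mono ?_
    rintro x ⟨t, hx, hu⟩
    exact ⟨⟨t, hx⟩, hu⟩

/-- Definable maps with finite fibres do not lower the dimension. -/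
theorem RankGE.image {s : X → Prop} (hs : Dfn L M s) {f : X → Y} (hf : Dfn L M f) {n : ℕ}
    (hfin : ∀ y, {x | s x ∧ f x = y}.Finite) (hn : RankGE L M s n) :
    RankGE L M (fun y => ∃ x, s x ∧ f x = y) n := by
  induction n generalizing s with
  | zero =>
    obtain ⟨x, hx⟩ := rankGE_zero.1 hn
    exact rankGE_zero.2 ⟨f x, x, hx, rfl⟩
  | succ n ih =>
    obtain ⟨i, hi⟩ := rankGE_succ.1 hn
    refine (rankGE_succ_of_finite (W := fun t y => ∃ x, (s x ∧ crd L M i x = t) ∧ f x = y)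
      (by fun_prop) (hi.mono fun t ht => ih (by fun_prop) (fun y => (hfin y).subset
        fun x hx => ⟨hx.1.1, hx.2⟩) ht) fun y => ?_).mono ?_
    · refine ((hfin y).image (crd L M i)).subset ?_
      rintro t ⟨x, hx, hy⟩
      exact ⟨x, ⟨hx.1, hy⟩, hx.2⟩
    · rintro y ⟨t, x, hx, hy⟩
      exact ⟨x, hx.1, hy⟩

theorem RankGE.add {s : X → Prop} (hs : Dfn L M s) {f : X → Y} (hf : Dfn L M f) {m d : ℕ}
    {r : Y → Prop} (hr : Dfn L M r) (hd : ∀ y, r y → RankGE L M (fun x => s x ∧ f x = y) d)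
    (hm : RankGE L M r m) : RankGE L M s (m + d) := by
  induction m generalizing s r with
  | zero =>
    obtain ⟨y, hy⟩ := rankGE_zero.1 hm
    rw [zero_add]
    exact (hd y hy).mono fun x hx => hx.1
  | succ m ih =>
    obtain ⟨i, hi⟩ := rankGE_succ.1 hm
    rw [add_right_comm]
    refine (rankGE_succ_of_finite (W := fun t x => s x ∧ crd L M i (f x) = t) (by fun_prop)
      (hi.mono fun t ht => ih (by fun_prop) (r := fun y => r y ∧ crd L M i y = t) (by fun_prop)
        ?_ ht) fun x => ?_).mono fun x ⟨t, hx⟩ => hx.1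
    · rintro y ⟨hy, rfl⟩
      refine (hd y hy).mono ?_
      rintro x ⟨hx, rfl⟩
      exact ⟨⟨hx, rfl⟩, rfl⟩
    · exact (Set.finite_singleton (crd L M i (f x))).subset fun t ht => ht.2.symm

end Dimension

section Classes

variable {L : FirstOrder.Language} {M : Type} [L.Structure M] [LinearOrder M]
  [h : Fact (OMinimal L M)] [DenselyOrdered M] [NoMinOrder M] [NoMaxOrder M] [Nonempty M]
variable {X T : Type} [Srt L M X] [Srt L M T]

theorem finite_image_classes {E : X → X → Prop} (hE : Dfn L M fun p : X × X => E p.1 p.2)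
    (hEq : Equivalence E) {s : X → Prop} (hs : Dfn L M s) {n : ℕ}
    (hn : ¬ RankGE L M s (n + 1)) :
    ((fun x => {y | E x y}) '' {x | RankGE L M (fun y => s y ∧ E x y) n}).Finite := by
  induction n generalizing s with
  | zero =>
    rw [zero_add, rankGE_one, Set.not_infinite] at hn
    refine (hn.image fun x => {y | E x y}).subset ?_
    rintro _ ⟨x, hx, rfl⟩
    obtain ⟨y, hy, hxy⟩ := (rankGE_zero (L := L) (M := M)).1 hx
    exact ⟨y, hy, Set.ext fun z => ⟨fun hz => hEq.trans hxy hz, fun hz =>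
      hEq.trans (hEq.symm hxy) hz⟩⟩
  | succ n ih =>
    have key : ∀ i : Idx L M X, ((fun x => {y | E x y}) ''
        {x | {t | RankGE L M (fun y => (s y ∧ E x y) ∧ crd L M i y = t) n}.Infinite}).Finite := by
      intro i
      by_contra hinf
      have hbad : {t | RankGE L M (fun y => s y ∧ crd L M i y = t) (n + 1)}.Finite := by
        by_contra hbad
        exact hn (rankGE_succ.2 ⟨i, hbad⟩)
      have hd1 : Dfn L M fun z : X × M =>
          RankGE L M (fun y => (s y ∧ E z.1 y) ∧ crd L M i y = z.2) n := by fun_prop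
      have hd2 : Dfn L M fun z : X × M =>
          RankGE L M (fun y => s y ∧ crd L M i y = z.2) (n + 1) := by fun_prop
      obtain ⟨t, ht⟩ := exists_infinite_image (L := L) (fun x => {y | E x y})
        (S := fun x => {t | RankGE L M (fun y => (s y ∧ E x y) ∧ crd L M i y = t) n}.Infinite)
        (dfn_infinite (L := L) hd1)
        (p := fun x t => RankGE L M (fun y => (s y ∧ E x y) ∧ crd L M i y = t) n ∧
          ¬ RankGE L M (fun y => s y ∧ crd L M i y = t) (n + 1))
        (dfn_and hd1 (dfn_not hd2))
        (fun x x' hxx => by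
          have : E x = E x' := hxx
          rw [this])
        hinf (fun x hx => (Set.Infinite.sdiff hx hbad).mono fun t ht => ⟨ht.1, ht.2⟩)
      obtain ⟨_, x, hx, -⟩ := ht.nonempty
      refine ht ((ih (s := fun y => s y ∧ crd L M i y = t) (by fun_prop) hx.2.2).subset
        (Set.image_mono fun x hx => hx.2.1.mono fun y hy => ⟨⟨hy.1.1, hy.2⟩, hy.1.2⟩))
    refine (Set.finite_iUnion key).subset ?_
    rintro _ ⟨x, hx, rfl⟩
    obtain ⟨i, hi⟩ := rankGE_succ.1 hx
    exact Set.mem_iUnion.2 ⟨i, x, hi, rfl⟩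

/-- A definable equivalence relation has only finitely many classes of full dimension. -/
theorem finite_classes {E : X → X → Prop} (hE : Dfn L M fun p : X × X => E p.1 p.2)
    (hEq : Equivalence E) {s : X → Prop} (hs : Dfn L M s) {n : ℕ}
    (hn : ¬ RankGE L M s (n + 1)) :
    ∃ F : Set X, F.Finite ∧ (∀ z ∈ F, RankGE L M (fun y => s y ∧ E z y) n) ∧
      ∀ x, RankGE L M (fun y => s y ∧ E x y) n → ∃ z ∈ F, E x z := by
  obtain ⟨F, hFs, hF⟩ := Set.exists_subset_bijOn {x | RankGE L M (fun y => s y ∧ E x y) n}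
    (fun x => {y | E x y})
  refine ⟨F, hF.finite_iff_finite.2 (finite_image_classes hE hEq hs hn), hFs, fun x hx => ?_⟩
  obtain ⟨z, hz, hzx⟩ := hF.surjOn (Set.mem_image_of_mem _ hx)
  have : z ∈ {y | E z y} := hEq.refl z
  rw [show {y | E z y} = _ from hzx] at this
  exact ⟨z, hz, this⟩

theorem not_bdry_iff [TopologicalSpace M] [OrderTopology M] {p : M → Prop} {u : M} :
    ¬ Bdry p u ↔ ∀ᶠ v in nhds u, p v ↔ p u := by
  unfold Bdry
  rw [not_not]
  constructor
  · rintro ⟨a, b, hau, hub, h⟩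
    filter_upwards [Ioo_mem_nhds hau hub] with v hv
    rcases h with h | h
    · exact iff_of_true (h v hv.1 hv.2) (h u hau hub)
    · exact iff_of_false (h v hv.1 hv.2) (h u hau hub)
  · intro hev
    obtain ⟨a, b, hu, hab⟩ := (mem_nhds_iff_exists_Ioo_subset).1 hev
    refine ⟨a, b, hu.1, hu.2, ?_⟩
    by_cases hp : p u
    · exact Or.inl fun y h1 h2 => (hab ⟨h1, h2⟩).2 hp
    · exact Or.inr fun y h1 h2 hy => hp ((hab ⟨h1, h2⟩).1 hy)

/-- If a directed definable family of equivalence relations with finitely many classes is such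
that increasing families of finite subsets of `M` indexed by it are bounded, then the intersection
of the family has a class of full dimension. -/
theorem exists_class_of_directed {r : T → T → Prop} (hT : Nonempty T)
    (hdir : ∀ t t', ∃ t'', r t'' t ∧ r t'' t')
    (hfub : ∀ Z : M → T → Prop, (Dfn L M fun p : M × T => Z p.1 p.2) →
      (∀ u t t', Z u t' → r t t' → Z u t) → (∀ t, {u | Z u t}.Finite) → {u | ∃ t, Z u t}.Finite)
    {E : T → X → X → Prop} (hE : Dfn L M fun p : T × X × X => E p.1 p.2.1 p.2.2)
    (hEq : ∀ t, Equivalence (E t)) (hmono : ∀ t t' x y, r t t' → E t x y → E t' x y)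
    {s : X → Prop} (hs : Dfn L M s)
    (hfin : ∀ t, ∃ F : Set X, F.Finite ∧ ∀ x, s x → ∃ z ∈ F, E t x z)
    {n : ℕ} (hn : RankGE L M s n) (hn' : ¬ RankGE L M s (n + 1)) :
    ∃ x, s x ∧ RankGE L M (fun y => s y ∧ ∀ t, E t x y) n := by
  induction n generalizing s with
  | zero =>
    obtain ⟨x, hx⟩ := rankGE_zero.1 hn
    exact ⟨x, hx, rankGE_zero.2 ⟨x, hx, fun t => (hEq t).refl x⟩⟩
  | succ n ih =>
    obtain ⟨i, hi⟩ := rankGE_succ.1 hn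
    set P : T → X → M → Prop := fun t x u =>
      RankGE L M (fun y => s y ∧ crd L M i y = u ∧ E t x y) n with hP
    have hPd : Dfn L M fun p : T × X × M => P p.1 p.2.1 p.2.2 := by
      simp only [hP]
      fun_prop
    have hPE : ∀ t x z, E t x z → P t x = P t z := fun t x z hxz => by
      have : E t x = E t z := funext fun y => propext
        ⟨(hEq t).trans ((hEq t).symm hxz), (hEq t).trans hxz⟩
      simp only [hP, this]
    have hPmono : ∀ t t' x z u, r t t' → E t' x z → P t z u → P t' x u := by
      intro t t' x z u hr hxz hz
      rw [hP] at hz ⊢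
      exact hz.mono fun y hy => ⟨hy.1, hy.2.1, (hEq t').trans hxz (hmono _ _ _ _ hr hy.2.2)⟩
    have hPsplit : ∀ t t' x u, r t t' → P t' x u →
        ∀ F : Set X, F.Finite → (∀ x, s x → ∃ z ∈ F, E t x z) →
        ∃ z ∈ F, (∃ y, s y ∧ E t y z) ∧ E t' x z ∧ P t z u := by
      intro t t' x u hr hx F hF hFs
      rw [hP] at hx
      obtain ⟨z, hz, hzn⟩ := exists_rankGE_of_finite hF (s := fun z y =>
        (s y ∧ crd L M i y = u ∧ E t' x y) ∧ E t y z) (hx.mono fun y hy => by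
          obtain ⟨z, hz, hyz⟩ := hFs y hy.1
          exact ⟨z, hz, hy, hyz⟩)
      obtain ⟨y, hy, hyz⟩ := hzn.nonempty
      refine ⟨z, hz, ⟨y, hy.1, hyz⟩, (hEq t').trans hy.2.2 (hmono _ _ _ _ hr hyz), ?_⟩
      rw [hP]
      exact hzn.mono fun y hy => ⟨hy.1.1, hy.1.2.1, (hEq t).symm hy.2⟩
    clear_value P
    have hZ : {u | ∃ t x, s x ∧ Bdry (P t x) u}.Finite := by
      refine hfub (fun u t => ∃ x, s x ∧ Bdry (P t x) u) (by unfold Bdry; fun_prop) ?_ ?_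
      · rintro u t t' ⟨x, hx, hu⟩ hr
        let _ := Preorder.topology M
        have : OrderTopology M := ⟨rfl⟩
        by_contra! hcon
        refine not_bdry_iff.2 ?_ hu
        obtain ⟨F, hF, hFs⟩ := hfin t
        have hev : ∀ᶠ v in nhds u, ∀ z ∈ F, (∃ y, s y ∧ E t y z) → (P t z v ↔ P t z u) := by
          refine (Filter.eventually_all_finite hF).2 fun z hz => ?_
          by_cases hy : ∃ y, s y ∧ E t y z
          · obtain ⟨y, hy, hyz⟩ := hy
            filter_upwards [not_bdry_iff.1 (hcon y hy)] with v hv _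
            rwa [← hPE t y z hyz]
          · exact Filter.Eventually.of_forall fun v hyz => absurd hyz hy
        filter_upwards [hev] with v hv
        constructor <;> intro hxv <;>
          obtain ⟨z, hz, hy, hxz, hzv⟩ := hPsplit t t' x _ hr hxv F hF hFs
        · exact hPmono t t' x z _ hr hxz ((hv z hz hy).1 hzv)
        · exact hPmono t t' x z _ hr hxz ((hv z hz hy).2 hzv)
      · intro t
        obtain ⟨F, hF, hFs⟩ := hfin t
        refine (hF.biUnion fun z _ => bdry_finite L (s := P t z) (by fun_prop)).subset ?_
        rintro u ⟨x, hx, hu⟩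
        obtain ⟨z, hz, hxz⟩ := hFs x hx
        exact Set.mem_biUnion hz (show Bdry (P t z) u from hPE t x z hxz ▸ hu)
    have hbad : {u | RankGE L M (fun y => s y ∧ crd L M i y = u) (n + 1)}.Finite := by
      by_contra hbad
      exact hn' (rankGE_succ.2 ⟨i, hbad⟩)
    obtain ⟨a, b, hab, hI⟩ := (infinite_iff L (s := fun u =>
      RankGE L M (fun y => s y ∧ crd L M i y = u) n ∧
      ¬ RankGE L M (fun y => s y ∧ crd L M i y = u) (n + 1) ∧
      ¬ ∃ t x, s x ∧ Bdry (P t x) u) (by unfold Bdry; fun_prop)).1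
      (((hi.sdiff hbad).sdiff hZ).mono fun u hu => ⟨hu.1.1, hu.1.2, hu.2⟩)
    have hconst : ∀ t x u v, s x → a < u → u < b → a < v → v < b → P t x u → P t x v := by
      intro t x u v hx h1 h2 h3 h4 hu
      rcases lt_trichotomy u v with huv | rfl | huv
      · refine of_not_bdry L (s := P t x) (by fun_prop) huv hu fun z h5 h6 h7 => ?_
        exact (hI z (h1.trans_le h5) (h6.trans_lt h4)).2.2 ⟨t, x, hx, h7⟩
      · exact hu
      · by_contra hv
        refine of_not_bdry L (s := fun u => ¬ P t x u) (by fun_prop) huv hv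
          (fun z h5 h6 h7 => ?_) hu
        exact (hI z (h3.trans_le h5) (h6.trans_lt h2)).2.2 ⟨t, x, hx, bdry_not.1 h7⟩
    obtain ⟨u0, hau0, hu0b⟩ := exists_between hab
    obtain ⟨x0, ⟨hx0, -⟩, hx0n⟩ := ih (s := fun y => s y ∧ crd L M i y = u0) (by fun_prop)
      (fun t => (hfin t).imp fun F hF => ⟨hF.1, fun x hx => hF.2 x hx.1⟩)
      (hI u0 hau0 hu0b).1 (hI u0 hau0 hu0b).2.1
    have hPx0 : ∀ t u, a < u → u < b → P t x0 u := fun t u h1 h2 => by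
      refine hconst t x0 u0 u hx0 hau0 hu0b h1 h2 ?_
      rw [hP]
      exact hx0n.mono fun y hy => ⟨hy.1.1, hy.1.2, hy.2 t⟩
    refine ⟨x0, hx0, rankGE_succ.2 ⟨i, (Set.Ioo_infinite hab).mono fun u hu => ?_⟩⟩
    obtain ⟨-, hun, -⟩ := hI u hu.1 hu.2
    have hEq' : Equivalence fun x y => ∀ t, E t x y :=
      ⟨fun x t => (hEq t).refl x, fun h t => (hEq t).symm (h t),
        fun h1 h2 t => (hEq t).trans (h1 t) (h2 t)⟩
    obtain ⟨F, hF, hFn, hFx⟩ := finite_classes (L := L) (E := fun x y => ∀ t, E t x y)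
      (by fun_prop) hEq' (s := fun y => s y ∧ crd L M i y = u) (by fun_prop) hun
    have hex : ∀ t, ∃ z ∈ F, E t x0 z := fun t => by
      have h1 := hPx0 t u hu.1 hu.2
      rw [hP] at h1
      obtain ⟨y, hy, hyn⟩ := ih (s := fun y => s y ∧ crd L M i y = u ∧ E t x0 y) (by fun_prop)
        (fun t => (hfin t).imp fun F hF => ⟨hF.1, fun x hx => hF.2 x hx.1⟩) h1
        (fun h2 => hun (h2.mono fun y hy => ⟨hy.1, hy.2.1⟩))
      obtain ⟨z, hz, hyz⟩ := hFx y (hyn.mono fun w hw => ⟨⟨hw.1.1, hw.1.2.1⟩, hw.2⟩)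
      exact ⟨z, hz, (hEq t).trans hy.2.2 (hyz t)⟩
    have hall : ∃ z ∈ F, ∀ t, E t x0 z := by
      by_contra! hcon
      choose! τ hτ using hcon
      obtain ⟨t0, ht0⟩ : ∃ t0, ∀ z ∈ F, ∀ x y, E t0 x y → E (τ z) x y := by
        clear hFn hFx hex hτ
        induction F, hF using Set.Finite.induction_on with
        | empty => exact ⟨hT.some, fun z hz => absurd hz (Set.notMem_empty z)⟩
        | @insert z F _ _ ihF =>
          obtain ⟨t1, ht1⟩ := ihF
          obtain ⟨t0, h1, h2⟩ := hdir t1 (τ z)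
          refine ⟨t0, ?_⟩
          rintro w (rfl | hw) x y hxy
          · exact hmono _ _ _ _ h2 hxy
          · exact ht1 w hw x y (hmono _ _ _ _ h1 hxy)
      obtain ⟨z, hz, hxz⟩ := hex t0
      exact hτ z hz (ht0 z hz _ _ hxz)
    obtain ⟨z, hz, hxz⟩ := hall
    exact (hFn z hz).mono fun y hy => ⟨⟨hy.1.1, hEq'.trans hxz hy.2⟩, hy.1.2⟩

end Classes

section DefinableSubtype

variable {L : FirstOrder.Language} {M : Type} [L.Structure M] [LinearOrder M]
  [h : Fact (OMinimal L M)] {X Y : Type} [Srt L M X] [Srt L M Y]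

/-- The subtype cut out by a definable predicate, as a sort. -/
def DSub {P : X → Prop} (_ : Dfn L M P) : Type := {x // P x}

variable {P : X → Prop} {hP : Dfn L M P}

/-- The underlying element. -/
def DSub.val (x : DSub hP) : X := Subtype.val x

theorem DSub.prop (x : DSub hP) : P x.val := Subtype.property x

theorem DSub.val_injective : Function.Injective (DSub.val : DSub hP → X) :=
  Subtype.val_injective

/-- The element of the subtype given by an element satisfying the predicate. -/
def DSub.mk (x : X) (hx : P x) : DSub hP := ⟨x, hx⟩

theorem DSub.val_mk (x : X) (hx : P x) : (DSub.mk x hx : DSub hP).val = x := rfl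

instance : Srt L M (DSub hP) where
  Idx := Idx L M X
  finite_idx := inferInstance
  tuple x := enc L M x.val
  tuple_injective _ _ hxy := DSub.val_injective (enc_injective hxy)
  defin_range := Defin.congr (dfn_iff_defin.1 hP) fun _ =>
    ⟨fun ⟨x, hx⟩ => ⟨x.val, hx, x.prop⟩, fun ⟨x, hx, hPx⟩ => ⟨DSub.mk x hPx, hx⟩⟩

theorem dfn_val' : Dfn L M fun x : DSub hP => x.val := by
  refine Defin.congr (Defin.and ((defin_range L M (DSub hP)).reindex Sum.inl)
    (Defin.comp_eq Sum.inl Sum.inr)) fun z => ?_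
  constructor
  · rintro ⟨x, h1, h2⟩
    exact ⟨⟨x, h1⟩, h1.symm.trans h2⟩
  · rintro ⟨⟨x, h1⟩, h2⟩
    exact ⟨x, h1, h1.trans h2⟩

@[fun_prop]
theorem dfn_val {f : Y → DSub hP} (hf : Dfn L M f) : Dfn L M fun y => (f y).val :=
  dfn_comp dfn_val' hf

theorem dfn_of_val {f : Y → DSub hP} (hf : Dfn L M fun y => (f y).val) : Dfn L M f := hf

end DefinableSubtype

section Ring

variable {L : FirstOrder.Language} {M : Type} [L.Structure M] [LinearOrder M]
  [h : Fact (OMinimal L M)] [DenselyOrdered M] [NoMinOrder M] [NoMaxOrder M] [Nonempty M]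
  {B : Type} [CommRing B] [Srt L M B]

variable (L M B) in
/-- A commutative ring on a sort with definable operations. -/
class DfnRing : Prop where
  add : Dfn L M fun p : B × B => p.1 + p.2
  neg : Dfn L M fun x : B => -x
  mul : Dfn L M fun p : B × B => p.1 * p.2

variable [DfnRing L M B] {X : Type} [Srt L M X]

@[fun_prop]
theorem dfn_add {f g : X → B} (hf : Dfn L M f) (hg : Dfn L M g) : Dfn L M fun x => f x + g x :=
  dfn_comp (f := fun x => (f x, g x)) DfnRing.add (by fun_prop)

@[fun_prop]
theorem dfn_neg {f : X → B} (hf : Dfn L M f) : Dfn L M fun x => - f x :=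
  dfn_comp DfnRing.neg hf

@[fun_prop]
theorem dfn_mul {f g : X → B} (hf : Dfn L M f) (hg : Dfn L M g) : Dfn L M fun x => f x * g x :=
  dfn_comp (f := fun x => (f x, g x)) DfnRing.mul (by fun_prop)

@[fun_prop]
theorem dfn_sub {f g : X → B} (hf : Dfn L M f) (hg : Dfn L M g) :
    Dfn L M fun x => f x - g x := by
  simp only [sub_eq_add_neg]
  fun_prop

theorem RankGE.translate {s : B → Prop} (hs : Dfn L M s) {n : ℕ} (hn : RankGE L M s n) (c : B) :
    RankGE L M (fun x => s (x - c)) n := by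
  refine (hn.image hs (f := fun x => x + c) (by fun_prop) fun y =>
    (Set.finite_singleton (y - c)).subset ?_).mono ?_
  · rintro x ⟨-, rfl⟩
    simp
  · rintro _ ⟨x, hx, rfl⟩
    simpa using hx

section FullDimension

variable {n : ℕ} (hB : ¬ RankGE L M (fun _ : B => True) (n + 1))
include hB

theorem finite_classes_of_rankGE {A : AddSubgroup B} (hA : Dfn L M fun x => x ∈ A)
    (hn : RankGE L M (fun x => x ∈ A) n) :
    ∃ F : Set B, F.Finite ∧ ∀ x, ∃ z ∈ F, z - x ∈ A := by
  obtain ⟨F, hF, -, hFx⟩ := finite_classes (L := L) (M := M) (E := fun x y : B => y - x ∈ A)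
    (dfn_comp (f := fun p : B × B => p.2 - p.1) hA (by fun_prop))
    ⟨fun x => by simp, fun {x y} hxy => by simpa using A.neg_mem hxy,
      fun {x y z} hxy hyz => by simpa using A.add_mem hxy hyz⟩
    (s := fun _ => True) (by fun_prop) hB
  exact ⟨F, hF, fun x => hFx x ((hn.translate hA x).mono fun y hy => ⟨trivial, hy⟩)⟩

theorem finiteIndex_of_rankGE {A : AddSubgroup B} (hA : Dfn L M fun x => x ∈ A)
    (hn : RankGE L M (fun x => x ∈ A) n) : A.FiniteIndex := by
  obtain ⟨F, hF, hFx⟩ := finite_classes_of_rankGE hB hA hn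
  have : Finite F := hF
  have : Finite (B ⧸ A) := by
    refine Finite.of_surjective (fun z : F => (z.1 : B ⧸ A)) fun q => ?_
    obtain ⟨x, rfl⟩ := QuotientAddGroup.mk_surjective q
    obtain ⟨z, hz, hzx⟩ := hFx x
    refine ⟨⟨z, hz⟩, (QuotientAddGroup.eq.2 ?_).symm⟩
    rwa [neg_add_eq_sub]
  exact AddSubgroup.finiteIndex_of_finite_quotient

end FullDimension

/-- The subring generated by an ideal. -/
def idealSubring (I : Ideal B) : Subring B := (⊥ : Subring (B ⧸ I)).comap (Ideal.Quotient.mk I)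

theorem mem_idealSubring {I : Ideal B} {x : B} : x ∈ idealSubring I ↔ ∃ j : ℤ, x - j ∈ I := by
  rw [idealSubring, Subring.mem_comap, Subring.mem_bot]
  refine exists_congr fun j => ?_
  rw [← Ideal.Quotient.mk_eq_mk_iff_sub_mem, map_intCast, eq_comm]

theorem mem_idealSubring_iff {I : Ideal B} {m : ℕ} (hm : m ≠ 0) (hmI : (m : B) ∈ I) {x : B} :
    x ∈ idealSubring I ↔ ∃ j : Fin m, x - (j : ℕ) ∈ I := by
  rw [mem_idealSubring]
  constructor
  · rintro ⟨j, hj⟩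
    have hm' : (m : ℤ) ≠ 0 := by exact_mod_cast hm
    have h1 := Int.emod_nonneg j hm'
    have h2 := Int.emod_lt_of_pos j (by omega : 0 < (m : ℤ))
    refine ⟨⟨(j % m).toNat, by omega⟩, ?_⟩
    have h3 : (((j % m).toNat : ℕ) : B) = ((j % m : ℤ) : B) := by
      rw [← Int.cast_natCast, Int.toNat_of_nonneg h1]
    have h4 : (j : B) = ((j % m : ℤ) : B) + m * ((j / m : ℤ) : B) := by
      conv_lhs => rw [← Int.emod_add_mul_ediv j m]
      push_cast
      ring
    simp only [h3]
    have : x - ((j % m : ℤ) : B) = (x - j) + m * ((j / m : ℤ) : B) := by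
      rw [h4]; ring
    rw [this]
    exact I.add_mem hj (I.mul_mem_right _ hmI)
  · rintro ⟨j, hj⟩
    exact ⟨(j : ℕ), by simpa using hj⟩

theorem dfn_idealSubring {I : Ideal B} (hI : Dfn L M fun x => x ∈ I) {m : ℕ} (hm : m ≠ 0)
    (hmI : (m : B) ∈ I) : Dfn L M fun x => x ∈ idealSubring I := by
  simp only [mem_idealSubring_iff hm hmI]
  exact dfn_exists_finite fun j =>
    dfn_comp (f := fun x : B => x - ((j : ℕ) : B)) hI (by fun_prop)

variable {n : ℕ} (hB : ¬ RankGE L M (fun _ : B => True) (n + 1))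
  (hS : ∀ S : Subring B, (Dfn L M fun x => x ∈ S) → RankGE L M (fun x => x ∈ S) n)

include hS in
theorem rankGE_mul_natCast {m : ℕ} (hm : m ≠ 0) :
    RankGE L M (fun x : B => ∃ y, x = m * y) n := by
  have hmem : ∀ x : B, x ∈ Ideal.span {(m : B)} ↔ ∃ y, x = m * y := fun x =>
    Ideal.mem_span_singleton
  have hI : Dfn L M fun x => x ∈ Ideal.span {(m : B)} := by
    simp only [hmem]
    fun_prop
  have hmI := Ideal.mem_span_singleton_self (m : B)
  have h1 := hS _ (dfn_idealSubring hI hm hmI)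
  simp only [mem_idealSubring_iff hm hmI] at h1
  obtain ⟨j, -, hj⟩ := exists_rankGE_of_finite (F := Set.univ) Set.finite_univ
    (s := fun (j : Fin m) (x : B) => x - (j : ℕ) ∈ Ideal.span {(m : B)})
    (h1.mono fun x ⟨j, hj⟩ => ⟨j, trivial, hj⟩)
  refine (hj.translate (dfn_comp (f := fun x : B => x - ((j : ℕ) : B)) hI (by fun_prop))
    (-((j : ℕ) : B))).mono fun x hx => (hmem x).1 ?_
  simpa using hx

include hB in
theorem finite_annihilator {t : B} (ht : RankGE L M (fun x => ∃ y, x = t * y) n) :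
    {x | t * x = 0}.Finite := by
  by_contra hinf
  have h1 : RankGE L M (fun x => t * x = 0) 1 := rankGE_one.2 hinf
  refine hB (RankGE.add (s := fun _ : B => True) (by fun_prop) (f := fun x => t * x)
    (by fun_prop) (r := fun x => ∃ y, x = t * y) (by fun_prop) ?_ ht)
  rintro _ ⟨y, rfl⟩
  refine (h1.translate (by fun_prop) y).mono fun x hx => ⟨trivial, ?_⟩
  rwa [mul_sub, sub_eq_zero] at hx

include hB in
theorem RankGE.mul_image {t : B} (ht : RankGE L M (fun x => ∃ y, x = t * y) n) {s : B → Prop}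
    (hs : Dfn L M s) {d : ℕ} (hd : RankGE L M s d) :
    RankGE L M (fun y => ∃ x, s x ∧ t * x = y) d := by
  refine hd.image hs (by fun_prop) fun y => ?_
  by_cases hy : ∃ x, t * x = y
  · obtain ⟨x, rfl⟩ := hy
    refine ((finite_annihilator hB ht).image fun z => z + x).subset ?_
    rintro z ⟨-, hz⟩
    exact ⟨z - x, by simp [mul_sub, hz], by simp⟩
  · rw [not_exists] at hy
    exact Set.finite_empty.subset fun x hx => absurd hx.2 (hy x)

theorem dfn_fullPrincipal : Dfn L M fun t : B => RankGE L M (fun x => ∃ y, x = t * y) n := by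
  fun_prop

include hB hS in
theorem exists_smallest_subring : ∃ S₀ : Subring B, (Dfn L M fun x => x ∈ S₀) ∧
    ∀ S : Subring B, (Dfn L M fun x => x ∈ S) → S₀ ≤ S := by
  let T := DSub (dfn_fullPrincipal (L := L) (M := M) (B := B) (n := n))
  have hTmul : ∀ {s t : B}, RankGE L M (fun x => ∃ y, x = t * y) n →
      RankGE L M (fun x => ∃ y, x = s * y) n → RankGE L M (fun x => ∃ y, x = t * s * y) n := by
    intro s t ht hs
    refine (RankGE.mul_image hB ht (by fun_prop) hs).mono ?_
    rintro _ ⟨_, ⟨y, rfl⟩, rfl⟩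
    exact ⟨y, by ring⟩
  have hTnat : ∀ {m : ℕ}, m ≠ 0 → RankGE L M (fun x : B => ∃ y, x = m * y) n :=
    fun hm => rankGE_mul_natCast hS hm
  have hT1 : RankGE L M (fun x : B => ∃ y, x = 1 * y) n := by
    simpa using hTnat one_ne_zero
  have hfub : ∀ Z : M → T → Prop, (Dfn L M fun p : M × T => Z p.1 p.2) →
      (∀ u (t t' : T), Z u t' → (∃ b, t.val = t'.val * b) → Z u t) →
      (∀ t, {u | Z u t}.Finite) → {u | ∃ t, Z u t}.Finite := by
    intro Z hZ hmono hfin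
    by_contra hinf
    obtain ⟨d, hd, hd'⟩ := exists_rankGE_not_succ (L := L) (M := M)
      (s := fun t : B => RankGE L M (fun x => ∃ y, x = t * y) n) ⟨1, hT1⟩
    refine hd' ((rankGE_succ_of_finite (W := fun u b => ∃ t : T, t.val = b ∧ Z u t)
      (by fun_prop) (Set.Infinite.mono ?_ hinf) ?_).mono ?_)
    · rintro u ⟨t, ht⟩
      refine (RankGE.mul_image hB t.prop (by fun_prop) hd).mono ?_
      rintro _ ⟨x, hx, rfl⟩
      exact ⟨DSub.mk (t.val * x) (hTmul t.prop hx), rfl, hmono u _ t ht ⟨x, rfl⟩⟩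
    · intro b
      by_cases hb : ∃ t : T, t.val = b
      · obtain ⟨t, rfl⟩ := hb
        refine (hfin t).subset ?_
        rintro u ⟨t', ht', hu⟩
        exact DSub.val_injective ht' ▸ hu
      · exact Set.finite_empty.subset fun u ⟨t, ht, _⟩ => absurd ⟨t, ht⟩ hb
    · rintro _ ⟨u, t, rfl, -⟩
      exact t.prop
  have hspan : ∀ (t : B) (x y : B), (∃ b, y - x = t * b) ↔ y - x ∈ Ideal.span {t} :=
    fun t x y => Ideal.mem_span_singleton.symm
  obtain ⟨x₀, -, hx₀⟩ := exists_class_of_directed (L := L) (M := M)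
    (r := fun t t' : T => ∃ b, t.val = t'.val * b)
    ⟨DSub.mk 1 hT1⟩ (fun t t' => ⟨DSub.mk (t.val * t'.val) (hTmul t.prop t'.prop),
      ⟨t'.val, rfl⟩, ⟨t.val, mul_comm _ _⟩⟩) hfub
    (E := fun t x y => ∃ b, y - x = t.val * b) (by fun_prop)
    (fun t => by
      simp only [hspan]
      exact ⟨fun x => by simp, fun {x y} hxy => by simpa using neg_mem hxy,
        fun {x y z} hxy hyz => by simpa using add_mem hxy hyz⟩)
    (fun t t' x y ⟨b, hb⟩ ⟨c, hc⟩ => ⟨b * c, by rw [hc, hb, mul_assoc]⟩)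
    (s := fun _ => True) (by fun_prop)
    (fun t => by
      have hmem : ∀ x : B, x ∈ (Ideal.span {t.val}).toAddSubgroup ↔ ∃ b, x = t.val * b :=
        fun x => Ideal.mem_span_singleton
      obtain ⟨F, hF, hFx⟩ := finite_classes_of_rankGE (L := L) (M := M) hB
        (A := (Ideal.span {t.val}).toAddSubgroup)
        (by simp only [hmem]; fun_prop) (by simp only [hmem]; exact t.prop)
      refine ⟨F, hF, fun x _ => ?_⟩
      obtain ⟨z, hz, hzx⟩ := hFx x
      exact ⟨z, hz, (hmem _).1 hzx⟩)
    (by simpa using hT1) hB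
  let J : Ideal B := ⨅ t : T, Ideal.span {t.val}
  have hJ : ∀ x, x ∈ J ↔ ∀ t : T, ∃ b, x = t.val * b := fun x => by
    simp only [J, Ideal.mem_iInf, Ideal.mem_span_singleton]
    rfl
  have hJd : Dfn L M fun x => x ∈ J := by
    simp only [hJ]
    fun_prop
  have hJn : RankGE L M (fun x => x ∈ J) n := by
    refine (hx₀.translate (by fun_prop) (-x₀)).mono fun x hx => (hJ x).2 fun t => ?_
    simpa using hx.2 t
  have hJf : J.toAddSubgroup.FiniteIndex := finiteIndex_of_rankGE hB (A := J.toAddSubgroup) hJd hJn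
  have hJm : (J.toAddSubgroup.index : B) ∈ J := by
    have := J.toAddSubgroup.nsmul_index_mem 1
    simpa using this
  refine ⟨idealSubring J, dfn_idealSubring hJd hJf.index_ne_zero hJm, fun S hSd x hx => ?_⟩
  have hSf : S.toAddSubgroup.FiniteIndex :=
    finiteIndex_of_rankGE hB (A := S.toAddSubgroup) hSd (hS S hSd)
  obtain ⟨j, hj⟩ := mem_idealSubring.1 hx
  obtain ⟨b, hb⟩ := (hJ _).1 hj (DSub.mk _ (hTnat hSf.index_ne_zero))
  have h1 : x - j ∈ S := by
    rw [hb, DSub.val_mk, ← nsmul_eq_mul]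
    exact S.toAddSubgroup.nsmul_index_mem b
  simpa using S.add_mem h1 (intCast_mem S j)

end Ring

section Concrete

variable {L : FirstOrder.Language} {M : Type} [L.Structure M] [LinearOrder M]
  [h : Fact (OMinimal L M)] {k : ℕ}

theorem dfn_mem_iff {S : Set (Fin k → M)} : (Dfn L M fun x => x ∈ S) ↔ Defin L M S := by
  rw [dfn_iff_defin]
  exact iff_of_eq (congrArg (Defin L M) (Set.ext fun z =>
    ⟨fun ⟨x, hx, hxS⟩ => hx ▸ hxS, fun hz => ⟨z, rfl, hz⟩⟩))

theorem dfn_of_graph_on {C : Set (Fin k → M)} {f : (Fin k → M) → (Fin k → M) → (Fin k → M)}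
    (hf : Defin L M {p : (Fin k ⊕ Fin k ⊕ Fin k) → M |
      (fun i => p (Sum.inl i)) ∈ C ∧ (fun i => p (Sum.inr (Sum.inl i))) ∈ C ∧
      f (fun i => p (Sum.inl i)) (fun i => p (Sum.inr (Sum.inl i))) =
        fun i => p (Sum.inr (Sum.inr i))}) :
    Dfn L M fun p : (Fin k → M) × (Fin k → M) × (Fin k → M) =>
      p.1 ∈ C ∧ p.2.1 ∈ C ∧ f p.1 p.2.1 = p.2.2 := by
  rw [dfn_iff_defin]
  refine Defin.congr hf fun z => ?_
  constructor
  · rintro ⟨x, rfl, hx⟩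
    exact hx
  · intro hz
    refine ⟨(_, _, _), ?_, hz⟩
    funext i
    rcases i with i | i | i <;> rfl

theorem dfn_neg_of_graph_on {C : Set (Fin k → M)} {f : (Fin k → M) → (Fin k → M)}
    (hf : Defin L M {p : (Fin k ⊕ Fin k) → M |
      (fun i => p (Sum.inl i)) ∈ C ∧ f (fun i => p (Sum.inl i)) = fun i => p (Sum.inr i)}) :
    Dfn L M fun p : (Fin k → M) × (Fin k → M) => p.1 ∈ C ∧ f p.1 = p.2 := by
  rw [dfn_iff_defin]
  refine Defin.congr hf fun z => ?_
  constructor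
  · rintro ⟨x, rfl, hx⟩
    exact hx
  · intro hz
    refine ⟨(_, _), ?_, hz⟩
    funext i
    rcases i with i | i <;> rfl

theorem RankGE.anti {X : Type} [Srt L M X] {s : X → Prop} {m n : ℕ} (hs : RankGE L M s m)
    (hnm : n ≤ m) : RankGE L M s n := by
  induction hnm with
  | refl => exact hs
  | step _ ih => exact ih hs.of_succ

theorem rankGE_val_iff {X : Type} [Srt L M X] {P : X → Prop} {hP : Dfn L M P}
    {s : DSub hP → Prop} {n : ℕ} :
    RankGE L M (fun x => ∃ b : DSub hP, s b ∧ b.val = x) n ↔ RankGE L M s n := by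
  induction n generalizing s with
  | zero =>
    rw [rankGE_zero, rankGE_zero]
    exact ⟨fun ⟨_, b, hb, _⟩ => ⟨b, hb⟩, fun ⟨b, hb⟩ => ⟨_, b, hb, rfl⟩⟩
  | succ n ih =>
    rw [rankGE_succ, rankGE_succ]
    refine exists_congr fun i => iff_of_eq (congrArg Set.Infinite (Set.ext fun t => ?_))
    rw [Set.mem_ofPred_eq, Set.mem_ofPred_eq,
      ← ih (s := fun x => s x ∧ crd L M (X := DSub hP) i x = t)]
    constructor <;> intro ht <;> refine ht.mono fun x hx => ?_
    · obtain ⟨⟨b, hb, rfl⟩, ht⟩ := hx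
      exact ⟨b, ⟨hb, ht⟩, rfl⟩
    · obtain ⟨b, ⟨hb, ht⟩, rfl⟩ := hx
      exact ⟨⟨b, hb, rfl⟩, ht⟩

/-- `S` is a definable commutative subring of `R` with multiplicative identity `e`. -/
structure IsUnitalSubring (R : DefRing L M) (e : Fin R.k → M) (S : Set (Fin R.k → M)) : Prop where
  dfn : Dfn L M fun x => x ∈ S
  subring : R.IsSubringSet S
  mem : e ∈ S
  comm : ∀ x ∈ S, ∀ y ∈ S, R.mul x y = R.mul y x
  one_mul : ∀ x ∈ S, R.mul e x = x

namespace IsUnitalSubring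

variable {R : DefRing L M} {e : Fin R.k → M} {S : Set (Fin R.k → M)}

theorem mono (hS : IsUnitalSubring R e S) {S' : Set (Fin R.k → M)}
    (hd : Dfn L M fun x => x ∈ S') (hS' : R.IsSubringSet S') (he : e ∈ S') (hss : S' ⊆ S) :
    IsUnitalSubring R e S' where
  dfn := hd
  subring := hS'
  mem := he
  comm x hx y hy := hS.comm x (hss hx) y (hss hy)
  one_mul x hx := hS.one_mul x (hss hx)

/-- The underlying sort. -/
abbrev Carrier (hS : IsUnitalSubring R e S) : Type := DSub hS.dfn

instance (hS : IsUnitalSubring R e S) : Add hS.Carrier :=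
  ⟨fun x y => DSub.mk (R.add x.val y.val) (hS.subring.2.2.1 _ x.prop _ y.prop)⟩

instance (hS : IsUnitalSubring R e S) : Mul hS.Carrier :=
  ⟨fun x y => DSub.mk (R.mul x.val y.val) (hS.subring.2.2.2.2 _ x.prop _ y.prop)⟩

instance (hS : IsUnitalSubring R e S) : Neg hS.Carrier :=
  ⟨fun x => DSub.mk (R.neg x.val) (hS.subring.2.2.2.1 _ x.prop)⟩

instance (hS : IsUnitalSubring R e S) : Zero hS.Carrier := ⟨DSub.mk R.zero hS.subring.2.1⟩

instance (hS : IsUnitalSubring R e S) : One hS.Carrier := ⟨DSub.mk e hS.mem⟩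

variable (hS : IsUnitalSubring R e S)


theorem val_mem (x : hS.Carrier) : x.val ∈ R.carrier := hS.subring.1 x.prop

instance : CommRing hS.Carrier where
  add_assoc x y z := DSub.val_injective
    (R.hadd_assoc _ (val_mem hS x) _ (val_mem hS y) _ (val_mem hS z))
  add_comm x y := DSub.val_injective (R.hadd_comm _ (val_mem hS x) _ (val_mem hS y))
  zero_add x := DSub.val_injective (R.hzero_add _ (val_mem hS x))
  add_zero x := DSub.val_injective (R.add_zero' (val_mem hS x))
  neg_add_cancel x := DSub.val_injective (R.hneg_add _ (val_mem hS x))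
  mul_assoc x y z := DSub.val_injective
    (R.hmul_assoc _ (val_mem hS x) _ (val_mem hS y) _ (val_mem hS z))
  mul_comm x y := DSub.val_injective (hS.comm _ x.prop _ y.prop)
  one_mul x := DSub.val_injective (hS.one_mul _ x.prop)
  mul_one x := DSub.val_injective ((hS.comm _ x.prop _ hS.mem).trans (hS.one_mul _ x.prop))
  left_distrib x y z := DSub.val_injective
    (R.hleft_distrib _ (val_mem hS x) _ (val_mem hS y) _ (val_mem hS z))
  right_distrib x y z := DSub.val_injective
    (R.hright_distrib _ (val_mem hS x) _ (val_mem hS y) _ (val_mem hS z))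
  zero_mul x := DSub.val_injective (R.zero_mul' (val_mem hS x))
  mul_zero x := DSub.val_injective (R.mul_zero' (val_mem hS x))
  nsmul := nsmulRec
  zsmul := zsmulRec

theorem dfn_op (hS : IsUnitalSubring R e S) {f : (Fin R.k → M) → (Fin R.k → M) → (Fin R.k → M)}
    (hf : Dfn L M fun p : (Fin R.k → M) × (Fin R.k → M) × (Fin R.k → M) =>
      p.1 ∈ R.carrier ∧ p.2.1 ∈ R.carrier ∧ f p.1 p.2.1 = p.2.2) :
    Dfn L M fun p : hS.Carrier × hS.Carrier => f p.1.val p.2.val := by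
  refine dfn_of_graph ?_
  have heq : (fun q : (hS.Carrier × hS.Carrier) × (Fin R.k → M) =>
      f q.1.1.val q.1.2.val = q.2) = fun q =>
      q.1.1.val ∈ R.carrier ∧ q.1.2.val ∈ R.carrier ∧ f q.1.1.val q.1.2.val = q.2 :=
    funext fun q => propext
      ⟨fun hq => ⟨val_mem hS q.1.1, val_mem hS q.1.2, hq⟩, fun hq => hq.2.2⟩
  rw [heq]
  exact dfn_comp (f := fun q : (hS.Carrier × hS.Carrier) × (Fin R.k → M) =>
    (q.1.1.val, q.1.2.val, q.2)) hf (by fun_prop)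

instance : DfnRing L M hS.Carrier where
  add := dfn_of_val (dfn_op hS (dfn_of_graph_on R.add_def))
  neg := by
    refine dfn_of_val (dfn_of_graph ?_)
    have heq : (fun q : hS.Carrier × (Fin R.k → M) => (-q.1).val = q.2) = fun q =>
        q.1.val ∈ R.carrier ∧ R.neg q.1.val = q.2 :=
      funext fun q => propext ⟨fun hq => ⟨val_mem hS q.1, hq⟩, fun hq => hq.2⟩
    rw [heq]
    exact dfn_comp (f := fun q : hS.Carrier × (Fin R.k → M) => (q.1.val, q.2))
      (dfn_neg_of_graph_on R.neg_def) (by fun_prop)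
  mul := dfn_of_val (dfn_op hS (dfn_of_graph_on R.mul_def))

/-- The image in `R` of a subring of `S`. -/
theorem image {U : Subring hS.Carrier} (hU : Dfn L M fun x => x ∈ U) :
    IsUnitalSubring R e {v | ∃ b : hS.Carrier, b ∈ U ∧ b.val = v} := by
  refine hS.mono ?_ ⟨?_, ⟨0, U.zero_mem, rfl⟩, ?_, ?_, ?_⟩ ⟨1, U.one_mem, rfl⟩ ?_
  · change Dfn L M fun v => ∃ b : hS.Carrier, b ∈ U ∧ b.val = v
    fun_prop
  · rintro _ ⟨b, -, rfl⟩
    exact val_mem hS b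
  · rintro _ ⟨a, ha, rfl⟩ _ ⟨b, hb, rfl⟩
    exact ⟨a + b, U.add_mem ha hb, rfl⟩
  · rintro _ ⟨a, ha, rfl⟩
    exact ⟨-a, U.neg_mem ha, rfl⟩
  · rintro _ ⟨a, ha, rfl⟩ _ ⟨b, hb, rfl⟩
    exact ⟨a * b, U.mul_mem ha hb, rfl⟩
  · rintro _ ⟨b, -, rfl⟩
    exact b.prop

/-- The trace on `S` of a subring of `R` containing `e`. -/
def trace {T : Set (Fin R.k → M)} (hT : R.IsSubringSet T) (he : e ∈ T) : Subring hS.Carrier where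
  carrier := {b | b.val ∈ T}
  mul_mem' ha hb := hT.2.2.2.2 _ ha _ hb
  one_mem' := he
  add_mem' ha hb := hT.2.2.1 _ ha _ hb
  zero_mem' := hT.2.1
  neg_mem' ha := hT.2.2.2.1 _ ha

end IsUnitalSubring

section Centralizer

variable {R : DefRing L M} {e : Fin R.k → M}

theorem mul_neg_eq {x y : Fin R.k → M} (hx : x ∈ R.carrier) (hy : y ∈ R.carrier) :
    R.mul x (R.neg y) = R.neg (R.mul x y) := by
  have hny := R.neg_mem y hy
  have hxy := R.mul_mem x hx y hy
  refine DefRing.add_left_cancel' hxy (R.mul_mem x hx _ hny) (R.neg_mem _ hxy) ?_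
  rw [← R.hleft_distrib x hx y hy _ hny, DefRing.add_neg' hy, DefRing.mul_zero' hx,
    DefRing.add_neg' hxy]

theorem neg_mul_eq {x y : Fin R.k → M} (hx : x ∈ R.carrier) (hy : y ∈ R.carrier) :
    R.mul (R.neg x) y = R.neg (R.mul x y) := by
  have hnx := R.neg_mem x hx
  have hxy := R.mul_mem x hx y hy
  refine DefRing.add_left_cancel' hxy (R.mul_mem _ hnx y hy) (R.neg_mem _ hxy) ?_
  rw [← R.hright_distrib x hx _ hnx y hy, DefRing.add_neg' hx, DefRing.zero_mul' hy,
    DefRing.add_neg' hxy]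

/-- The elements of `e R e` commuting with every element that commutes with `e`. -/
def bicommutant (R : DefRing L M) (e : Fin R.k → M) : Set (Fin R.k → M) :=
  {x | x ∈ R.carrier ∧ R.mul e x = x ∧ R.mul x e = x ∧
    ∀ y ∈ R.carrier, R.mul e y = R.mul y e → R.mul x y = R.mul y x}

theorem dfn_bicommutant (he : e ∈ R.carrier) : Dfn L M fun x => x ∈ bicommutant R e := by
  have hmul := dfn_of_graph_on R.mul_def
  have heq : (fun x => x ∈ bicommutant R e) = fun x : Fin R.k → M =>
      (e ∈ R.carrier ∧ x ∈ R.carrier ∧ R.mul e x = x) ∧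
      (x ∈ R.carrier ∧ e ∈ R.carrier ∧ R.mul x e = x) ∧
      ∀ y, (∃ w, (e ∈ R.carrier ∧ y ∈ R.carrier ∧ R.mul e y = w) ∧
          (y ∈ R.carrier ∧ e ∈ R.carrier ∧ R.mul y e = w)) →
        ∃ w, (x ∈ R.carrier ∧ y ∈ R.carrier ∧ R.mul x y = w) ∧
          (y ∈ R.carrier ∧ x ∈ R.carrier ∧ R.mul y x = w) := by
    funext x
    refine propext ⟨?_, ?_⟩
    · rintro ⟨hx, h1, h2, h3⟩
      refine ⟨⟨he, hx, h1⟩, ⟨hx, he, h2⟩, ?_⟩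
      rintro y ⟨w, ⟨-, hy, hw⟩, -, -, hw'⟩
      exact ⟨_, ⟨hx, hy, rfl⟩, hy, hx, (h3 y hy (hw.trans hw'.symm)).symm⟩
    · rintro ⟨⟨-, hx, h1⟩, ⟨-, -, h2⟩, h3⟩
      refine ⟨hx, h1, h2, fun y hy hey => ?_⟩
      obtain ⟨w, ⟨-, -, hw⟩, -, -, hw'⟩ := h3 y ⟨_, ⟨he, hy, rfl⟩, hy, he, hey.symm⟩
      exact hw.trans hw'.symm
  rw [heq]
  have key : ∀ {X : Type} [Srt L M X] {f g t : X → Fin R.k → M}, Dfn L M f → Dfn L M g →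
      Dfn L M t → Dfn L M fun x => f x ∈ R.carrier ∧ g x ∈ R.carrier ∧ R.mul (f x) (g x) = t x :=
    fun {X _ f g t} hf hg ht =>
      dfn_comp (f := fun x => (f x, g x, t x)) hmul (by fun_prop)
  have d1 := key (X := Fin R.k → M) (f := fun _ => e) (g := fun x => x) (t := fun x => x)
    (by fun_prop) (by fun_prop) (by fun_prop)
  have d2 := key (X := Fin R.k → M) (f := fun x => x) (g := fun _ => e) (t := fun x => x)
    (by fun_prop) (by fun_prop) (by fun_prop)
  have d3 := key (X := ((Fin R.k → M) × (Fin R.k → M)) × (Fin R.k → M))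
    (f := fun _ => e) (g := fun p => p.1.2) (t := fun p => p.2)
    (by fun_prop) (by fun_prop) (by fun_prop)
  have d4 := key (X := ((Fin R.k → M) × (Fin R.k → M)) × (Fin R.k → M))
    (f := fun p => p.1.2) (g := fun _ => e) (t := fun p => p.2)
    (by fun_prop) (by fun_prop) (by fun_prop)
  have d5 := key (X := ((Fin R.k → M) × (Fin R.k → M)) × (Fin R.k → M))
    (f := fun p => p.1.1) (g := fun p => p.1.2) (t := fun p => p.2)
    (by fun_prop) (by fun_prop) (by fun_prop)
  have d6 := key (X := ((Fin R.k → M) × (Fin R.k → M)) × (Fin R.k → M))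
    (f := fun p => p.1.2) (g := fun p => p.1.1) (t := fun p => p.2)
    (by fun_prop) (by fun_prop) (by fun_prop)
  fun_prop

theorem isUnitalSubring_bicommutant (he : e ∈ R.carrier) (hee : R.mul e e = e) :
    IsUnitalSubring R e (bicommutant R e) where
  dfn := dfn_bicommutant he
  subring := by
    refine ⟨fun x hx => hx.1, ⟨R.zero_mem, R.mul_zero' he, R.zero_mul' he, fun y hy _ => ?_⟩,
      ?_, ?_, ?_⟩
    · rw [R.zero_mul' hy, R.mul_zero' hy]
    · rintro x ⟨hx, hx1, hx2, hx3⟩ y ⟨hy, hy1, hy2, hy3⟩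
      refine ⟨R.add_mem x hx y hy, ?_, ?_, fun z hz hez => ?_⟩
      · rw [R.hleft_distrib e he x hx y hy, hx1, hy1]
      · rw [R.hright_distrib x hx y hy e he, hx2, hy2]
      · rw [R.hright_distrib x hx y hy z hz, R.hleft_distrib z hz x hx y hy, hx3 z hz hez,
          hy3 z hz hez]
    · rintro x ⟨hx, hx1, hx2, hx3⟩
      refine ⟨R.neg_mem x hx, ?_, ?_, fun z hz hez => ?_⟩
      · rw [mul_neg_eq he hx, hx1]
      · rw [neg_mul_eq hx he, hx2]
      · rw [neg_mul_eq hx hz, mul_neg_eq hz hx, hx3 z hz hez]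
    · rintro x ⟨hx, hx1, hx2, hx3⟩ y ⟨hy, hy1, hy2, hy3⟩
      refine ⟨R.mul_mem x hx y hy, ?_, ?_, fun z hz hez => ?_⟩
      · rw [← R.hmul_assoc e he x hx y hy, hx1]
      · rw [R.hmul_assoc x hx y hy e he, hy2]
      · rw [R.hmul_assoc x hx y hy z hz, hy3 z hz hez, ← R.hmul_assoc x hx z hz y hy,
          hx3 z hz hez, R.hmul_assoc z hz x hx y hy]
  mem := ⟨he, hee, hee, fun _ _ hy => hy⟩
  comm x hx y hy := hx.2.2.2 y hy.1 (hy.2.1.trans hy.2.2.1.symm)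
  one_mul x hx := hx.2.1

end Centralizer

theorem exists_rank_minimal {R : DefRing L M} {e : Fin R.k → M} (he : e ∈ R.carrier)
    (hee : R.mul e e = e) :
    ∃ (n : ℕ) (S : Set (Fin R.k → M)), IsUnitalSubring R e S ∧
      ¬ RankGE L M (fun x => x ∈ S) (n + 1) ∧
      ∀ S', IsUnitalSubring R e S' → RankGE L M (fun x => x ∈ S') n := by
  classical
  have hex : ∃ n, ∃ S : Set (Fin R.k → M), IsUnitalSubring R e S ∧
      ¬ RankGE L M (fun x => x ∈ S) (n + 1) := by
    obtain ⟨n, -, hn⟩ := exists_rankGE_not_succ (L := L) (M := M)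
      (s := fun x => x ∈ bicommutant R e) ⟨e, (isUnitalSubring_bicommutant he hee).mem⟩
    exact ⟨n, _, isUnitalSubring_bicommutant he hee, hn⟩
  obtain ⟨S, hS, hn⟩ := Nat.find_spec hex
  refine ⟨_, S, hS, hn, fun S' hS' => ?_⟩
  obtain ⟨m, hm, hm'⟩ := exists_rankGE_not_succ (L := L) (M := M)
    (s := fun x => x ∈ S') ⟨e, hS'.mem⟩
  exact hm.anti (Nat.find_min' hex ⟨S', hS', hm'⟩)

end Concrete

/-- If `e` is a nonzero idempotent of a definably connected
definable ring `R`, then there is a smallest definable subring `R(e)` of `R`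
containing `e`, and `e` is a multiplicative identity of `R(e)`. -/
theorem statement_18 {L : FirstOrder.Language} {M : Type} [L.Structure M] [LinearOrder M]
    (hM : OMinimal L M) (R : DefRing L M) (hconn : DefConnected L M R.carrier)
    (e : Fin R.k → M) (he : R.IsIdempotent e) (hne : e ≠ R.zero) :
    ∃ S, R.IsSmallestDefSubringContaining e S ∧
      ∀ x ∈ S, R.mul e x = x ∧ R.mul x e = x := by
  have : Fact (OMinimal L M) := ⟨hM⟩
  obtain ⟨_, _, _, _, -⟩ := hM
  obtain ⟨n, S, hS, hn, hmin⟩ := exists_rank_minimal he.1 he.2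
  obtain ⟨U, hU, hUmin⟩ := exists_smallest_subring (L := L) (M := M) (B := hS.Carrier) (n := n)
    (fun hB => hn ((rankGE_val_iff.2 hB).mono fun x ⟨b, _, hb⟩ => hb ▸ b.prop))
    (fun U hU => rankGE_val_iff.1 (hmin _ (hS.image hU)))
  have hI := hS.image hU
  refine ⟨_, ⟨⟨dfn_mem_iff.1 hI.dfn, hI.subring⟩, hI.mem, ?_⟩, fun x hx =>
    ⟨hI.one_mul x hx, (hI.comm x hx e hI.mem).trans (hI.one_mul x hx)⟩⟩
  rintro T ⟨hTd, hT⟩ heT _ ⟨b, hb, rfl⟩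
  refine hUmin (hS.trace hT heT) ?_ hb
  exact dfn_comp (f := fun b : hS.Carrier => b.val) (dfn_mem_iff.2 hTd) (by fun_prop)

end OMin
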